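/- arXiv:2010.14249 — 7 statements merged into one kernel-verified Lean document; each statement's English description precedes it below -/
import Mathlib

section
/- Let G be a finite connected simple graph with at least one edge in which every vertex has even degree, and suppose there is a fixed residue i ∈ {0,1,2,3} such that every cycle of G has length congruent to i modulo 4. If G is regular (all vertices have the same degree), then G is a cycle graph, i.e., G is isomorphic to the cycle graph C_n for some n ≥ 3. -/
namespace SimpleGraph
variable {V : Type*} {G : SimpleGraph V}

/-- A list of pairwise distinct vertices, consecutive ones being adjacent. -/
def IsPathList (G : SimpleGraph V) (l : List V) : Prop :=
  l.IsChain G.Adj ∧ l.Nodup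

lemma IsPathList.exists_isCycle {x y : V} {M : List V} (h : G.IsPathList (x :: M ++ [y]))
    (hM : M ≠ []) (hxy : G.Adj y x) :
    ∃ c : G.Walk y y, c.IsCycle ∧ c.length = M.length + 2 := by
  obtain ⟨hc, hn⟩ := h
  have key : ∀ (l : List V) (hne : l ≠ []) (_ : l.IsChain G.Adj) {a b : V},
      l.head hne = a → l.getLast hne = b → ∃ p : G.Walk a b, p.support = l := by
    rintro l hne hl a b rfl rfl
    exact ⟨Walk.ofSupport l hne hl, Walk.support_ofSupport hne hl⟩
  obtain ⟨p, hp⟩ := key (x :: M ++ [y]) (by simp) hc (a := x) (b := y) (by simp) (by simp)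
  have hlen : p.length = M.length + 1 := by
    have := p.length_support
    rw [hp] at this
    simpa using this.symm
  refine ⟨Walk.cons hxy p, ?_, by simp [hlen]⟩
  have := List.length_pos_iff.mpr hM
  rw [Walk.isCycle_iff_isPath_tail_and_le_length]
  refine ⟨?_, by simp [hlen]; omega⟩
  have hp' : p.IsPath := by rw [Walk.isPath_def, hp]; exact hn
  simpa using hp'

lemma IsPathList.rotate {x z : V} {A B : List V} (h : G.IsPathList (x :: A ++ z :: B))
    (hxz : G.Adj x z) : G.IsPathList ((x :: A).reverse ++ z :: B) := by
  obtain ⟨hc, hn⟩ := h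
  constructor
  · rw [List.isChain_append] at hc ⊢
    refine ⟨?_, hc.2.1, ?_⟩
    · rw [List.isChain_reverse]
      exact hc.1.imp fun _ _ h => h.symm
    · simpa using hxz
  · exact (((x :: A).reverse_perm.append_right _).nodup_iff).mpr hn

lemma IsPathList.of_infix {l l' : List V} (h : G.IsPathList l) (hl : l' <:+: l) :
    G.IsPathList l' :=
  ⟨h.1.infix hl, h.2.sublist hl.sublist⟩

/-- `w` is the last neighbour of `x` on the longest path `x :: M ++ w :: C`. -/
structure IsFarthestSplit (G : SimpleGraph V) (x : V) (M : List V) (w : V) (C : List V) :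
    Prop where
  isPathList : G.IsPathList (x :: M ++ w :: C)
  longest : ∀ l, G.IsPathList l → l.length ≤ (x :: M ++ w :: C).length
  adj : G.Adj x w
  not_adj : ∀ u ∈ C, ¬ G.Adj x u

end SimpleGraph

lemma List.exists_last_split {α : Type*} {p : α → Prop} {l : List α} (h : ∃ a ∈ l, p a) :
    ∃ M a C, l = M ++ a :: C ∧ p a ∧ ∀ u ∈ C, ¬ p u := by
  induction l with
  | nil => simp at h
  | cons b t ih =>
    by_cases ht : ∃ a ∈ t, p a
    · obtain ⟨M, a, C, rfl, ha, hC⟩ := ih ht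
      exact ⟨b :: M, a, C, rfl, ha, hC⟩
    · push Not at ht
      obtain ⟨a, ha, hpa⟩ := h
      rcases List.mem_cons.mp ha with rfl | ha
      · exact ⟨[], a, t, rfl, hpa, ht⟩
      · exact absurd hpa (ht a ha)

namespace SimpleGraph
variable {V : Type*} {G : SimpleGraph V}

lemma IsPathList.mem_of_adj_head {x u : V} {t : List V} (h : G.IsPathList (x :: t))
    (hmax : ∀ l, G.IsPathList l → l.length ≤ (x :: t).length) (hu : G.Adj x u) : u ∈ t := by
  by_contra hut
  have := hmax (u :: x :: t) ⟨List.IsChain.cons_cons hu.symm h.1,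
    List.nodup_cons.mpr ⟨by simp [hu.ne', hut], h.2⟩⟩
  simp at this

lemma exists_isFarthestSplit [Finite V] [Nonempty V] (h : ∀ v, ∃ u, G.Adj v u) :
    ∃ x M w C, G.IsFarthestSplit x M w C := by
  have : Fintype V := Fintype.ofFinite V
  obtain ⟨l, hl, hmax⟩ : ∃ l, G.IsPathList l ∧ ∀ l', G.IsPathList l' → l'.length ≤ l.length := by
    have hb : BddAbove (List.length '' {l | G.IsPathList l}) :=
      ⟨Fintype.card V, by rintro _ ⟨l, hl, rfl⟩; exact hl.2.length_le_card⟩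
    have hne : (List.length '' {l | G.IsPathList l}).Nonempty :=
      ⟨_, [], ⟨List.isChain_nil, List.nodup_nil⟩, rfl⟩
    obtain ⟨l, hl, hle⟩ := Nat.sSup_mem hne hb
    exact ⟨l, hl, fun l' hl' => hle ▸ le_csSup hb ⟨l', hl', rfl⟩⟩
  obtain _ | ⟨x, t⟩ := l
  · have := hmax [Classical.arbitrary V] ⟨by simp, by simp⟩
    simp at this
  · obtain ⟨u, hu⟩ := h x
    obtain ⟨M, w, C, rfl, hw, hC⟩ := List.exists_last_split (p := G.Adj x)
      ⟨u, hl.mem_of_adj_head hmax hu, hu⟩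
    exact ⟨x, M, w, C, hl, hmax, hw, hC⟩

/-- Some vertex has degree at most two if all cycle lengths agree modulo four. -/
lemma exists_degree_le_two [Fintype V] [Nonempty V] [DecidableRel G.Adj] {i : ℕ}
    (hcyc : ∀ (u : V) (c : G.Walk u u), c.IsCycle → c.length % 4 = i) :
    ∃ v, G.degree v ≤ 2 := by
  classical
  by_contra! hdeg
  have hcyc' {x y : V} {M : List V} (h : G.IsPathList (x :: M ++ [y])) (hM : M ≠ [])
      (hxy : G.Adj y x) : (M.length + 2) % 4 = i := by
    obtain ⟨c, hc, hlen⟩ := h.exists_isCycle hM hxy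
    rw [← hlen]
    exact hcyc y c hc
  have hex : ∃ n x M w C, G.IsFarthestSplit x M w C ∧ M.length = n := by
    obtain ⟨x, M, w, C, h⟩ := G.exists_isFarthestSplit fun v => by
      have : 0 < G.degree v := by have := hdeg v; omega
      exact (G.degree_pos_iff_exists_adj v).mp this
    exact ⟨_, x, M, w, C, h, rfl⟩
  obtain ⟨x, M, w, C, hs, hlen⟩ := Nat.find_spec hex
  have hmin {x' M' w' C'} (h : G.IsFarthestSplit x' M' w' C') : M.length ≤ M'.length := by
    rw [hlen]
    exact Nat.find_min' hex ⟨x', M', w', C', h, rfl⟩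
  obtain ⟨A, z, B, rfl, hA, hxz⟩ : ∃ A z B, M = A ++ z :: B ∧ A ≠ [] ∧ G.Adj x z := by
    obtain _ | ⟨s, M⟩ := M
    · have : G.neighborFinset x ⊆ {w} := by
        intro u hu
        rw [mem_neighborFinset] at hu
        have := hs.isPathList.mem_of_adj_head hs.longest hu
        have := hs.not_adj u
        simp_all
      have := Finset.card_le_card this
      rw [card_neighborFinset_eq_degree, Finset.card_singleton] at this
      have := hdeg x
      omega
    · obtain ⟨z, hz, hzs, hzw⟩ : ∃ z, G.Adj x z ∧ z ≠ s ∧ z ≠ w := by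
        by_contra! hcon
        have : G.neighborFinset x ⊆ {s, w} := by
          intro u hu
          rw [mem_neighborFinset] at hu
          have := hcon u hu
          simp
          tauto
        have := (Finset.card_le_card this).trans Finset.card_le_two
        rw [card_neighborFinset_eq_degree] at this
        have := hdeg x
        omega
      have hzM : z ∈ M := by
        have h1 := hs.isPathList.mem_of_adj_head hs.longest hz
        have h2 := hs.not_adj z
        simp_all
      obtain ⟨A, B, rfl⟩ := List.append_of_mem hzM
      exact ⟨s :: A, z, B, rfl, by simp, hz⟩
  obtain ⟨hpath, hlong, hxw, -⟩ := hs
  have hcyc_z := hcyc' (x := x) (M := A) (y := z) (hpath.of_infix ⟨[], B ++ w :: C, by simp⟩) hA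
    hxz.symm
  have hcyc_w := hcyc' (x := x) (M := A ++ z :: B) (y := w) (hpath.of_infix ⟨[], C, by simp⟩)
    (by simp) hxw.symm
  obtain ⟨A', y, rfl⟩ := A.eq_nil_or_concat'.resolve_left hA
  have hrot : G.IsPathList (y :: (A'.reverse ++ x :: z :: B ++ w :: C)) := by
    simpa using IsPathList.rotate (x := x) (A := A' ++ [y]) (z := z) (B := B ++ w :: C)
      (by simpa using hpath) hxz
  have hcyc_chord := hcyc' (x := x) (M := z :: B) (y := w)
    (hrot.of_infix ⟨y :: A'.reverse, C, by simp⟩) (by simp) hxw.symm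
  have hlong' : ∀ l, G.IsPathList l →
      l.length ≤ (y :: (A'.reverse ++ x :: z :: B ++ w :: C)).length := by
    intro l hl
    have := hlong l hl
    simp at this ⊢
    omega
  have hyz : G.Adj y z := by
    have := hpath.of_infix (l' := [y, z]) ⟨x :: A', B ++ w :: C, by simp⟩
    simpa using this.1
  obtain ⟨M', u, N, hM', hyu, hN⟩ := List.exists_last_split (p := G.Adj y)
    ⟨z, hrot.mem_of_adj_head hlong' hyz, hyz⟩
  rw [hM'] at hrot hlong'
  have hle := hmin ⟨hrot, hlong', hyu, hN⟩
  obtain ⟨D, hD, hD'⟩ : ∃ D, w :: C = D ++ u :: N ∧ M' = A'.reverse ++ x :: z :: B ++ D := by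
    rcases List.append_eq_append_iff.mp hM' with ⟨D, h1, h2⟩ | ⟨D, h1, h2⟩
    · exact ⟨D, h2, h1⟩
    · have : D = [] := by
        have := congrArg List.length h1
        simp at this hle
        exact List.length_eq_zero_iff.mp (by omega)
      subst this
      exact ⟨[], by simpa using h2.symm, by simpa using h1.symm⟩
  have hcyc_rot := hcyc' (x := y) (M := M') (y := u) (hrot.of_infix ⟨[], N, by simp⟩)
    (by simp [hD']) hyu.symm
  have hrotD : G.IsPathList (y :: (A'.reverse ++ x :: z :: B ++ D ++ u :: N)) := by
    simpa [hD'] using hrot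
  have hcyc_cross : (D.length + 4) % 4 = i := by
    have hseg : G.IsPathList (D ++ [u]) :=
      hrotD.of_infix ⟨y :: (A'.reverse ++ x :: z :: B), N, by simp⟩
    have hwD : ∃ E, D ++ [u] = w :: E := by
      obtain _ | ⟨d, D⟩ := D
      · simp at hD
        exact ⟨[], by simp [hD.1]⟩
      · simp at hD
        exact ⟨D ++ [u], by simp [hD.1]⟩
    obtain ⟨E, hE⟩ := hwD
    have hpl : G.IsPathList (D ++ [u] ++ [y, z, x]) := by
      refine ⟨List.isChain_append.mpr ⟨hseg.1, by simp [hyz, hxz.symm], by simp [hyu.symm]⟩, ?_⟩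
      have hsub : (y :: ([x, z] ++ (D ++ [u]))).Nodup := by
        refine hrotD.2.sublist (.cons_cons _ ?_)
        have h1 : [x, z].Sublist (A'.reverse ++ x :: z :: B) :=
          List.IsInfix.sublist ⟨A'.reverse, B, by simp⟩
        have h2 : (D ++ [u]).Sublist (D ++ u :: N) :=
          List.IsInfix.sublist ⟨[], N, by simp⟩
        rw [List.append_assoc (bs := D)]
        exact h1.append h2
      exact (List.perm_append_comm.trans (.append_left _ (.cons y (.swap z x [])))).nodup hsub
    rw [hE] at hpl
    have := hcyc' (x := w) (M := E ++ [y, z]) (y := x) (by simpa using hpl) (by simp) hxw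
    have hlenE := congrArg List.length hE
    simp at hlenE this
    omega
  subst hD'
  simp at hcyc_z hcyc_w hcyc_chord hcyc_rot
  omega

lemma Connected.nonempty_iso_cycleGraph [Fintype V] [DecidableRel G.Adj] (hconn : G.Connected)
    (h : G.IsRegularOfDegree 2) : ∃ n : ℕ, 3 ≤ n ∧ Nonempty (G ≃g cycleGraph n) := by
  classical
  have hcard (v : V) : (G.neighborSet v).ncard = 2 := by
    rw [← h v, ← card_neighborSet_eq_degree, Set.ncard_eq_toFinset_card', Set.toFinset_card]
  obtain ⟨v⟩ := hconn.nonempty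
  obtain ⟨p, hp, hverts⟩ := IsCycles.exists_cycle_toSubgraph_verts_eq_connectedComponentSupp
    (c := G.connectedComponentMk v) (fun w _ => hcard w) rfl
    (Set.nonempty_of_ncard_ne_zero (by simp [hcard]))
  have hsupp (w : V) : w ∈ p.support := by
    rw [← Walk.mem_verts_toSubgraph, hverts]
    exact ConnectedComponent.sound (hconn.preconnected w v)
  obtain ⟨n, hn⟩ := Nat.exists_eq_add_of_le' hp.three_le_length
  let f : Fin (n + 3) → V := fun k => p.getVert k
  have hinj : Function.Injective f := fun a b hab =>
    Fin.ext (hp.getVert_injOn' (by simp; omega) (by simp; omega) hab)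
  have hsurj : Function.Surjective f := by
    intro w
    obtain ⟨k, rfl, hk⟩ := Walk.mem_support_iff_exists_getVert.mp (hsupp w)
    rcases hk.lt_or_eq with hk | rfl
    · exact ⟨⟨k, by omega⟩, rfl⟩
    · exact ⟨0, by simp [f]⟩
  have hsucc (a : Fin (n + 3)) : G.Adj (f a) (f (a + 1)) := by
    have := p.adj_getVert_succ (i := a) (by omega)
    convert this using 1
    rcases eq_or_ne a (Fin.last _) with rfl | ha
    · simp [f, ← hn]
    · simp [f, Fin.val_add_one_of_lt (Fin.lt_last_iff_ne_last.mpr ha)]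
  have hadj {a b : Fin (n + 3)} (hab : (cycleGraph (n + 3)).Adj a b) : G.Adj (f a) (f b) := by
    rw [cycleGraph_adj, sub_eq_iff_eq_add', sub_eq_iff_eq_add'] at hab
    rcases hab with rfl | rfl
    · simpa [add_comm] using (hsucc b).symm
    · simpa [add_comm] using hsucc a
  have himg (a : Fin (n + 3)) :
      ((cycleGraph (n + 3)).neighborFinset a).image f = G.neighborFinset (f a) := by
    refine Finset.eq_of_subset_of_card_le ?_ ?_
    · intro w hw
      obtain ⟨b, hb, rfl⟩ := Finset.mem_image.mp hw
      rw [mem_neighborFinset] at hb ⊢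
      exact hadj hb
    · rw [Finset.card_image_of_injective _ hinj, card_neighborFinset_eq_degree,
        card_neighborFinset_eq_degree, h, cycleGraph_degree_three_le]
  refine ⟨n + 3, by omega, ⟨RelIso.symm ⟨Equiv.ofBijective f ⟨hinj, hsurj⟩, ?_⟩⟩⟩
  intro a b
  refine ⟨fun hab => ?_, hadj⟩
  have hb : f b ∈ G.neighborFinset (f a) := (mem_neighborFinset ..).mpr hab
  rw [← himg, Finset.mem_image] at hb
  obtain ⟨c, hc, hcb⟩ := hb
  rwa [← hinj hcb, ← mem_neighborFinset]

end SimpleGraph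

/-- An Euler graph (finite, connected, at least one edge, all degrees even)
all of whose cycles have length congruent to a fixed `i ∈ {0,1,2,3}` modulo 4,
if regular, is isomorphic to a cycle graph `C_n` for some `n ≥ 3`. -/
theorem euler_one_cycle_type_regular_is_cycle_graph
    {V : Type*} [Fintype V] (G : SimpleGraph V) [DecidableRel G.Adj]
    (hconn : G.Connected) (hedge : G.edgeSet.Nonempty)
    (heven : ∀ v : V, Even (G.degree v))
    (i : ℕ) (hi : i < 4)
    (hcyc : ∀ (u : V) (c : G.Walk u u), c.IsCycle → c.length % 4 = i)
    (hreg : ∃ r : ℕ, G.IsRegularOfDegree r) :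
    ∃ n : ℕ, 3 ≤ n ∧ Nonempty (G ≃g SimpleGraph.cycleGraph n) := by
  have := hconn.nonempty
  obtain ⟨r, hr⟩ := hreg
  obtain ⟨v, hv⟩ := SimpleGraph.exists_degree_le_two hcyc
  obtain ⟨e, he⟩ := hedge
  induction e with | _ a b
  have hpos : 0 < G.degree a := (G.degree_pos_iff_exists_adj a).mpr ⟨b, he⟩
  have hev := heven a
  rw [hr a] at hpos hev
  rw [hr v] at hv
  obtain ⟨k, rfl⟩ := hev
  obtain rfl : k = 1 := by omega
  exact hconn.nonempty_iso_cycleGraph hr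
end

section
/- Let G be a finite connected simple graph with at least one edge in which every vertex has even degree, and suppose there is a fixed residue i ∈ {0,1,2,3} such that every cycle of G has length congruent to i modulo 4. Then G is regular and bipartite if and only if G is isomorphic to the cycle graph C_n for some even n ≥ 4. -/
namespace SimpleGraph

variable {V W : Type*} {G : SimpleGraph V}

/-- An injective homomorphism into a connected graph that preserves degrees is an isomorphism. -/
theorem nonempty_iso_of_injective_of_degree_eq {H : SimpleGraph W} [Nonempty W] [H.LocallyFinite]
    [G.LocallyFinite] (hG : G.Connected) (f : H →g G) (hf : Function.Injective f)
    (hdeg : ∀ x, G.degree (f x) = H.degree x) : Nonempty (H ≃g G) := by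
  have key : ∀ x v, G.Adj (f x) v → ∃ y, H.Adj x y ∧ f y = v := by
    intro x v hv
    have hsub : (H.neighborFinset x).map ⟨f, hf⟩ ⊆ G.neighborFinset (f x) := by
      intro w hw
      obtain ⟨y, hy, rfl⟩ := Finset.mem_map.mp hw
      simpa using f.map_adj (by simpa using hy)
    have heq := Finset.eq_of_subset_of_card_le hsub (by simp [hdeg])
    have hmem : v ∈ (H.neighborFinset x).map ⟨f, hf⟩ := by simpa [heq] using hv
    simpa using hmem
  have hsurj : Function.Surjective f := by
    intro v
    obtain ⟨x⟩ := ‹Nonempty W›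
    obtain ⟨p⟩ := hG.preconnected v (f x)
    generalize hw : f x = w at p
    induction p with
    | nil => exact ⟨x, hw⟩
    | cons h _ ih =>
      obtain ⟨y, rfl⟩ := ih hw
      obtain ⟨z, -, hz⟩ := key y _ h.symm
      exact ⟨z, hz⟩
  refine ⟨⟨Equiv.ofBijective f ⟨hf, hsurj⟩, ?_⟩⟩
  intro x y
  refine ⟨fun h => ?_, fun h => f.map_adj h⟩
  obtain ⟨z, hz, hzy⟩ := key x _ h
  exact hf hzy ▸ hz

/-- A finite connected `2`-regular graph is a cycle graph. -/
theorem Connected.exists_iso_cycleGraph_of_isRegularOfDegree_two [Fintype V] [DecidableRel G.Adj]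
    (hG : G.Connected) (hreg : G.IsRegularOfDegree 2) :
    ∃ n, 3 ≤ n ∧ Nonempty (G ≃g cycleGraph n) := by
  have hnt : Nontrivial V := by
    obtain ⟨v⟩ := hG.nonempty
    have hpos : 0 < G.degree v := by rw [hreg v]; norm_num
    obtain ⟨w, hw⟩ := (G.degree_pos_iff_exists_adj v).mp hpos
    exact ⟨v, w, hw.ne⟩
  have hcyc : ¬ G.IsAcyclic := by
    intro hac
    have htree : G.IsTree := ⟨hG, hac⟩
    obtain ⟨v, hv⟩ := htree.exists_vert_degree_one_of_nontrivial
    have := hreg v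
    omega
  rw [isAcyclic_iff_free_cycleGraph] at hcyc
  push Not at hcyc
  obtain ⟨n, hn, ⟨f⟩⟩ := hcyc
  obtain ⟨m, rfl⟩ := Nat.exists_eq_add_of_le' hn
  obtain ⟨e⟩ := nonempty_iso_of_injective_of_degree_eq hG f.toHom f.injective
    fun x => by rw [hreg, cycleGraph_degree_three_le]
  exact ⟨m + 3, hn, ⟨e.symm⟩⟩

/-- The sequence `f` lists, on the indices `0, …, k`, the vertices of a path of `G`. -/
def IsPathSeq (G : SimpleGraph V) (f : ℕ → V) (k : ℕ) : Prop :=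
  Set.InjOn f (Set.Iic k) ∧ ∀ j < k, G.Adj (f j) (f (j + 1))

namespace IsPathSeq

variable {f : ℕ → V} {k : ℕ}

theorem inj (hf : IsPathSeq G f k) {a b : ℕ} (ha : a ≤ k) (hb : b ≤ k) (h : f a = f b) : a = b :=
  hf.1 ha hb h

theorem lt_card [Fintype V] (hf : IsPathSeq G f k) : k < Fintype.card V := by
  have := Finset.card_le_card_of_injOn (s := Finset.Iic k) (t := Finset.univ) f (by simp)
    (by simpa using hf.1)
  simpa using this

theorem exists_walk (hf : IsPathSeq G f k) {l r : ℕ} (hlr : l ≤ r) (hrk : r ≤ k) :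
    ∃ p : G.Walk (f l) (f r), p.IsPath ∧ p.length = r - l ∧
      ∀ v ∈ p.support, ∃ j, l ≤ j ∧ j ≤ r ∧ f j = v := by
  induction hlr using Nat.decreasingInduction with
  | self => exact ⟨.nil, by simp, by simp, by simpa using ⟨r, le_rfl, le_rfl, rfl⟩⟩
  | of_succ l hl ih =>
    obtain ⟨p, hp, hlen, hsupp⟩ := ih
    refine ⟨.cons (hf.2 l (by omega)) p, ?_, ?_, ?_⟩
    · refine (Walk.cons_isPath_iff _ _).mpr ⟨hp, fun h => ?_⟩
      obtain ⟨j, h1, h2, h3⟩ := hsupp _ h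
      have := hf.inj (by omega) (by omega) h3
      omega
    · simp only [Walk.length_cons]
      omega
    · intro v hv
      rcases List.mem_cons.mp (by simpa using hv) with rfl | hv
      · exact ⟨l, le_rfl, hl.le, rfl⟩
      · obtain ⟨j, h1, h2, h3⟩ := hsupp _ hv
        exact ⟨j, by omega, h2, h3⟩

theorem cons (hf : IsPathSeq G f k) {v : V} (hv : G.Adj v (f 0)) (hne : ∀ j ≤ k, f j ≠ v) :
    IsPathSeq G (fun j => if j = 0 then v else f (j - 1)) (k + 1) := by
  constructor
  · intro a ha b hb hab
    simp only [Set.mem_Iic] at ha hb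
    dsimp only at hab
    split_ifs at hab with h1 h2 h2
    · omega
    · exact absurd hab.symm (hne _ (by omega))
    · exact absurd hab (hne _ (by omega))
    · have := hf.inj (by omega) (by omega) hab
      omega
  · rintro (_ | j) hj
    · simpa using hv
    · simpa using hf.2 j (by omega)

/-- Reversing the part of a path before a neighbor of its first vertex gives a path. -/
theorem rotate (hf : IsPathSeq G f k) {a : ℕ} (ha : 1 ≤ a) (hak : a ≤ k)
    (hadj : G.Adj (f 0) (f a)) :
    IsPathSeq G (fun j => if j < a then f (a - 1 - j) else f j) k := by
  constructor
  · intro b hb c hc hbc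
    simp only [Set.mem_Iic] at hb hc
    dsimp only at hbc
    split_ifs at hbc with h1 h2 h2 <;> have := hf.inj (by omega) (by omega) hbc <;> omega
  · intro j hj
    dsimp only
    split_ifs with h1 h2 h2
    · have := hf.2 (a - 1 - (j + 1)) (by omega)
      rw [show a - 1 - (j + 1) + 1 = a - 1 - j by omega] at this
      exact this.symm
    · obtain rfl : a = j + 1 := by omega
      simpa using hadj
    · omega
    · exact hf.2 j hj

end IsPathSeq

/-- The first vertex of a longest path has all its neighbors on the path. -/
theorem IsPathSeq.exists_of_adj {f : ℕ → V} {k : ℕ} (hf : IsPathSeq G f k)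
    (hmax : ∀ g, ¬ IsPathSeq G g (k + 1)) {v : V} (hv : G.Adj (f 0) v) :
    ∃ j, 1 ≤ j ∧ j ≤ k ∧ f j = v := by
  by_contra! hcon
  refine hmax _ (hf.cons hv.symm fun j hj => ?_)
  rcases Nat.eq_zero_or_pos j with rfl | hpos
  · exact hv.ne
  · exact hcon j hpos hj

/-- In minimum degree at least three, the first vertex of a longest path has a neighbor on the path
whose index avoids any two prescribed values. -/
theorem IsPathSeq.exists_adj_ne_ne [Fintype V] [DecidableRel G.Adj] {f : ℕ → V} {k : ℕ}
    (hf : IsPathSeq G f k) (hmax : ∀ g, ¬ IsPathSeq G g (k + 1)) (hdeg : ∀ v, 3 ≤ G.degree v)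
    (a b : ℕ) : ∃ j, 1 ≤ j ∧ j ≤ k ∧ j ≠ a ∧ j ≠ b ∧ G.Adj (f 0) (f j) := by
  classical
  have hcard : ({f a, f b} : Finset V).card < (G.neighborFinset (f 0)).card := by
    have := hdeg (f 0)
    have := Finset.card_le_two (a := f a) (b := f b)
    rw [card_neighborFinset_eq_degree]
    omega
  obtain ⟨v, hv, hvn⟩ := Finset.exists_mem_notMem_of_card_lt_card hcard
  rw [mem_neighborFinset] at hv
  obtain ⟨j, h1, h2, rfl⟩ := hf.exists_of_adj hmax hv
  exact ⟨j, h1, h2, by rintro rfl; simp at hvn, by rintro rfl; simp at hvn, hv⟩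

theorem length_add_one_mod_of_isPath {m i : ℕ}
    (hcyc : ∀ (u : V) (c : G.Walk u u), c.IsCycle → c.length % m = i)
    {u v : V} (p : G.Walk u v) (hp : p.IsPath) (hlen : 2 ≤ p.length) (h : G.Adj v u) :
    (p.length + 1) % m = i := by
  refine hcyc v (.cons h p) ((Walk.cons_isCycle_iff _ _).mpr ⟨hp, fun hmem => ?_⟩)
  rw [Sym2.eq_swap] at hmem
  have := hp.length_eq_one_of_mem_edges hmem
  omega

/-- A finite graph of minimum degree at least three has two cycles whose lengths differ
modulo four. -/
theorem exists_isCycle_length_mod_four_ne [Fintype V] [Nonempty V] [DecidableRel G.Adj]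
    (hdeg : ∀ v, 3 ≤ G.degree v) (i : ℕ) :
    ∃ (u : V) (c : G.Walk u u), c.IsCycle ∧ c.length % 4 ≠ i := by
  classical
  by_contra! hcyc
  obtain ⟨k, ⟨f₀, hf₀⟩, hmax⟩ : ∃ k, (∃ f, IsPathSeq G f k) ∧ ∀ g, ¬ IsPathSeq G g (k + 1) := by
    by_contra! hcon
    have hall : ∀ k, ∃ f, IsPathSeq G f k := by
      intro k
      induction k with
      | zero =>
        obtain ⟨v⟩ := ‹Nonempty V›
        exact ⟨fun _ => v, by intro a ha b hb _; simp_all, by simp⟩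
      | succ k ih => exact hcon k ih
    obtain ⟨f, hf⟩ := hall (Fintype.card V)
    exact hf.lt_card.false
  have hex : ∃ a, 2 ≤ a ∧ a ≤ k ∧ ∃ f, IsPathSeq G f k ∧ G.Adj (f 0) (f a) := by
    obtain ⟨j, h1, h2, h3, -, h4⟩ := hf₀.exists_adj_ne_ne hmax hdeg 1 1
    exact ⟨j, by omega, h2, f₀, hf₀, h4⟩
  obtain ⟨ha2, hak, f, hf, hfa⟩ := Nat.find_spec hex
  have hmin : ∀ j g, 2 ≤ j → j ≤ k → IsPathSeq G g k → G.Adj (g 0) (g j) → Nat.find hex ≤ j :=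
    fun j g h1 h2 h3 h4 => Nat.find_min' hex ⟨h1, h2, g, h3, h4⟩
  generalize Nat.find hex = a at *
  obtain ⟨c, hc1, hck, hcne, hca, hfc⟩ := hf.exists_adj_ne_ne hmax hdeg 1 a
  have hac : a < c := lt_of_le_of_ne (hmin c f (by omega) hck hf hfc) (Ne.symm hca)
  have hg := hf.rotate (by omega) hak hfa
  obtain ⟨b, hb1, hbk, hbne, hba, hgb⟩ := hg.exists_adj_ne_ne hmax hdeg 1 a
  have hab : a < b := lt_of_le_of_ne (hmin b _ (by omega) hbk hg hgb) (Ne.symm hba)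
  simp only [show 0 < a by omega, show ¬ b < a by omega, if_true, if_false, Nat.sub_zero] at hgb
  have hpred : G.Adj (f (a - 1)) (f a) := by
    simpa [show a - 1 + 1 = a by omega] using hf.2 (a - 1) (by omega)
  have hinitial : ∀ j, 2 ≤ j → j ≤ k → G.Adj (f 0) (f j) → (j + 1) % 4 = i := by
    intro j h1 h2 h3
    obtain ⟨p, hp, hlen, -⟩ := hf.exists_walk (Nat.zero_le j) h2
    have := length_add_one_mod_of_isPath hcyc p hp (by omega) h3.symm
    rwa [hlen, Nat.sub_zero] at this
  have hia := hinitial a ha2 hak hfa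
  have hic := hinitial c (by omega) hck hfc
  have hib : (b - (a - 1) + 1) % 4 = i := by
    obtain ⟨p, hp, hlen, -⟩ := hf.exists_walk (show a - 1 ≤ b by omega) hbk
    have := length_add_one_mod_of_isPath hcyc p hp (by omega) hgb.symm
    rwa [hlen] at this
  have hiac : (c - a + 2) % 4 = i := by
    obtain ⟨p, hp, hlen, hsupp⟩ := hf.exists_walk hac.le hck
    have hq : (Walk.cons hfa p).IsPath := by
      refine (Walk.cons_isPath_iff _ _).mpr ⟨hp, fun h => ?_⟩
      obtain ⟨j, h1, h2, h3⟩ := hsupp _ h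
      have := hf.inj (by omega) (by omega) h3
      omega
    have := length_add_one_mod_of_isPath hcyc _ hq (by simp; omega) hfc.symm
    rwa [Walk.length_cons, hlen] at this
  rcases le_total c b with hcb | hbc
  · obtain ⟨p, hp, hlen, hsupp⟩ := hf.exists_walk hcb hbk
    have hq : (Walk.cons hpred (.cons hfa.symm (.cons hfc p))).IsPath := by
      simp only [Walk.cons_isPath_iff, Walk.support_cons, List.mem_cons, not_or]
      refine ⟨⟨⟨hp, fun h => ?_⟩, hfa.ne', fun h => ?_⟩, hpred.ne, fun h => ?_, fun h => ?_⟩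
      on_goal 3 => have := hf.inj (by omega) (by omega) h; omega
      all_goals
        obtain ⟨j, h1, h2, h3⟩ := hsupp _ h
        have := hf.inj (by omega) (by omega) h3
        omega
    have := length_add_one_mod_of_isPath hcyc _ hq (by simp) hgb.symm
    simp only [Walk.length_cons, hlen] at this
    omega
  · obtain ⟨p, hp, hlen, hsupp⟩ := hf.exists_walk hbc hck
    have hq : (Walk.cons hfa (.cons hpred.symm (.cons hgb p))).IsPath := by
      simp only [Walk.cons_isPath_iff, Walk.support_cons, List.mem_cons, not_or]
      refine ⟨⟨⟨hp, fun h => ?_⟩, hpred.ne', fun h => ?_⟩, hfa.ne, fun h => ?_, fun h => ?_⟩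
      on_goal 3 => have := hf.inj (by omega) (by omega) h; omega
      all_goals
        obtain ⟨j, h1, h2, h3⟩ := hsupp _ h
        have := hf.inj (by omega) (by omega) h3
        omega
    have := length_add_one_mod_of_isPath hcyc _ hq (by simp) hfc.symm
    simp only [Walk.length_cons, hlen] at this
    omega

end SimpleGraph

/-- An Euler graph (finite, connected, at least one edge, all degrees even)
all of whose cycles have length congruent to a fixed `i ∈ {0,1,2,3}` modulo 4
is regular and bipartite if and only if it is isomorphic to a cycle graph `C_n`
for some even `n ≥ 4`. -/
theorem euler_one_cycle_type_regular_bipartite_iff_even_cycle_graph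
    {V : Type*} [Fintype V] (G : SimpleGraph V) [DecidableRel G.Adj]
    (hconn : G.Connected) (hedge : G.edgeSet.Nonempty)
    (heven : ∀ v : V, Even (G.degree v))
    (i : ℕ) (hi : i < 4)
    (hcyc : ∀ (u : V) (c : G.Walk u u), c.IsCycle → c.length % 4 = i) :
    ((∃ r : ℕ, G.IsRegularOfDegree r) ∧ G.Colorable 2) ↔
      ∃ n : ℕ, 4 ≤ n ∧ Even n ∧ Nonempty (G ≃g SimpleGraph.cycleGraph n) := by
  have := hconn.nonempty
  constructor
  · rintro ⟨⟨r, hr⟩, hcol⟩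
    obtain rfl : r = 2 := by
      obtain ⟨e, he⟩ := hedge
      induction e with
      | _ v w =>
        have hpos : 0 < G.degree v := (G.degree_pos_iff_exists_adj v).mpr ⟨w, he⟩
        obtain ⟨s, hs⟩ := heven v
        have hrv := hr v
        by_contra hne
        obtain ⟨u, c, hc, hmod⟩ := SimpleGraph.exists_isCycle_length_mod_four_ne (G := G)
          (fun x => by rw [hr x]; omega) i
        exact hmod (hcyc u c hc)
    obtain ⟨n, hn, ⟨e⟩⟩ := hconn.exists_iso_cycleGraph_of_isRegularOfDegree_two hr
    have hn_even : Even n := by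
      by_contra hodd
      have hchrom := SimpleGraph.chromaticNumber_cycleGraph_of_odd n (by omega)
        (Nat.not_even_iff_odd.mp hodd)
      have hle := (hcol.of_hom e.symm.toHom).chromaticNumber_le
      rw [hchrom] at hle
      exact absurd hle (by norm_num)
    obtain ⟨s, rfl⟩ := hn_even
    exact ⟨s + s, by omega, ⟨s, rfl⟩, ⟨e⟩⟩
  · rintro ⟨n, hn, hn_even, ⟨e⟩⟩
    refine ⟨⟨2, fun v => ?_⟩, ?_⟩
    · obtain ⟨m, rfl⟩ := Nat.exists_eq_add_of_le' (show 3 ≤ n by omega)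
      rw [← SimpleGraph.cycleGraph_degree_three_le (v := e v)]
      exact (e.degree_eq v).symm
    · exact (SimpleGraph.cycleGraph.bicoloring_of_even n hn_even).colorable.of_hom e.toHom
end

section
/- Let G be a finite connected simple graph in which every vertex has even degree, and suppose the set of residues modulo 4 of the lengths of the cycles of G is exactly the two-element set {i, j} with i ≠ j. If G is regular, then {i, j} = {0, 2}; equivalently, every cycle of G has even length, i.e., G is bipartite. -/
namespace SimpleGraph

variable {V : Type*} {G : SimpleGraph V}

/-- `f 0, f 1, …, f n` are the successive vertices of a path of `G`. -/
structure IsIndexedPath (G : SimpleGraph V) (f : ℕ → V) (n : ℕ) : Prop where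
  inj : ∀ a ≤ n, ∀ b ≤ n, f a = f b → a = b
  adj : ∀ k < n, G.Adj (f k) (f (k + 1))

/-- `G` contains a cycle with exactly `n` edges. -/
def HasCycleOfLength (G : SimpleGraph V) (n : ℕ) : Prop :=
  ∃ (u : V) (c : G.Walk u u), c.IsCycle ∧ c.length = n

theorem HasCycleOfLength.of_indexed {φ : ℕ → V} {N : ℕ} (hN : 3 ≤ N)
    (hinj : ∀ a < N, ∀ b < N, φ a = φ b → a = b)
    (hadj : ∀ k, k + 1 < N → G.Adj (φ k) (φ (k + 1)))
    (hclose : G.Adj (φ (N - 1)) (φ 0)) : G.HasCycleOfLength N := by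
  refine (cycleGraph_isContained_iff (by lia)).mp ⟨⟨⟨fun k ↦ φ k, ?_⟩, ?_⟩⟩
  · intro x y hxy
    wlog hle : x < y generalizing x y
    · have hne : x ≠ y := hxy.ne
      exact (this hxy.symm (by lia)).symm
    obtain ⟨x, hx⟩ := x
    obtain ⟨y, hy⟩ := y
    have hlt : x < y := hle
    rcases cycleGraph_adj'.mp hxy with h | h
    · rw [Fin.coe_sub_iff_lt.mpr hle] at h
      simp only at h ⊢
      obtain rfl : x = 0 := by lia
      obtain rfl : y = N - 1 := by lia
      exact hclose.symm
    · rw [Fin.sub_val_of_le hle.le] at h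
      simp only at h ⊢
      obtain rfl : y = x + 1 := by lia
      exact hadj x hy
  · intro x y h
    exact Fin.ext (hinj x x.2 y y.2 h)

theorem IsIndexedPath.hasCycleOfLength_of_reindex {f : ℕ → V} {n : ℕ} (hf : G.IsIndexedPath f n)
    {φ : ℕ → ℕ} {N : ℕ} (hN : 3 ≤ N) (hle : ∀ a < N, φ a ≤ n)
    (hinj : ∀ a < N, ∀ b < N, φ a = φ b → a = b)
    (hadj : ∀ k, k + 1 < N → G.Adj (f (φ k)) (f (φ (k + 1))))
    (hclose : G.Adj (f (φ (N - 1))) (f (φ 0))) : G.HasCycleOfLength N :=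
  .of_indexed (φ := f ∘ φ) hN
    (fun a ha b hb h ↦ hinj a ha b hb (hf.inj _ (hle a ha) _ (hle b hb) h)) hadj hclose

/-- Two disjoint segments of a path, joined end to end by two edges, form a cycle. -/
theorem IsIndexedPath.hasCycleOfLength_of_two_segments {f : ℕ → V} {n a b c d : ℕ}
    (hf : G.IsIndexedPath f n) (hab : a ≤ b) (hbc : b < c) (hcd : c ≤ d) (hdn : d ≤ n)
    (hlen : a < b ∨ c < d) (h₁ : G.Adj (f b) (f c)) (h₂ : G.Adj (f d) (f a)) :
    G.HasCycleOfLength (b - a + (d - c) + 2) := by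
  refine hf.hasCycleOfLength_of_reindex
    (φ := fun k ↦ if k ≤ b - a then a + k else c + (k - (b - a) - 1)) (by lia)
    (by intro k hk; split_ifs <;> lia)
    (by intro k hk l hl; split_ifs <;> lia) ?_ ?_
  · intro k hk
    rcases lt_trichotomy k (b - a) with h | h | h
    · rw [if_pos (by lia), if_pos (by lia)]
      exact hf.adj _ (by lia)
    · rw [if_pos (by lia), if_neg (by lia), show a + k = b by lia,
        show c + (k + 1 - (b - a) - 1) = c by lia]
      exact h₁
    · rw [if_neg (by lia), if_neg (by lia),
        show c + (k + 1 - (b - a) - 1) = c + (k - (b - a) - 1) + 1 by lia]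
      exact hf.adj _ (by lia)
  · rw [if_neg (by lia), if_pos (by lia),
      show c + (b - a + (d - c) + 2 - 1 - (b - a) - 1) = d by lia]
    exact h₂

/-- A segment of a path, closed up through three earlier vertices of the path, forms a cycle. -/
theorem IsIndexedPath.hasCycleOfLength_of_segment {f : ℕ → V} {n x y z c d : ℕ}
    (hf : G.IsIndexedPath f n) (hx : x < c) (hy : y < c) (hz : z < c) (hxz : x ≠ z)
    (hcd : c ≤ d) (hdn : d ≤ n) (hxy : G.Adj (f x) (f y)) (hyz : G.Adj (f y) (f z))
    (hzc : G.Adj (f z) (f c)) (hdx : G.Adj (f d) (f x)) :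
    G.HasCycleOfLength (d - c + 4) := by
  have hxy' : x ≠ y := by rintro rfl; exact hxy.ne rfl
  have hyz' : y ≠ z := by rintro rfl; exact hyz.ne rfl
  refine hf.hasCycleOfLength_of_reindex
    (φ := fun k ↦ if k = 0 then x else if k = 1 then y else if k = 2 then z else c + (k - 3))
    (by lia)
    (by intro k hk; split_ifs <;> lia)
    (by intro k hk l hl; split_ifs <;> lia) ?_ ?_
  · intro k hk
    match k with
    | 0 => simpa using hxy
    | 1 => simpa using hyz
    | 2 => simpa using hzc
    | k + 3 =>
      simp only [show ∀ t, t + 3 ≠ 0 ∧ t + 3 ≠ 1 ∧ t + 3 ≠ 2 by lia,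
        show k + 3 + 1 = k + 1 + 3 by lia, if_false, Nat.add_sub_cancel]
      exact hf.adj _ (by lia)
  · rw [if_neg (by lia), if_neg (by lia), if_neg (by lia), if_pos rfl,
      show c + (d - c + 4 - 1 - 3) = d by lia]
    exact hdx

/-- Reversing the initial segment of a path along an edge from its first vertex. -/
theorem IsIndexedPath.rotate {f : ℕ → V} {n i : ℕ} (hf : G.IsIndexedPath f n) (hi : 1 ≤ i)
    (hin : i ≤ n) (h : G.Adj (f 0) (f i)) :
    G.IsIndexedPath (fun k ↦ f (if k < i then i - 1 - k else k)) n where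
  inj a ha b hb hab := by
    have := hf.inj _ (by split_ifs <;> lia) _ (by split_ifs <;> lia) hab
    split_ifs at this <;> lia
  adj k hk := by
    rcases lt_trichotomy (k + 1) i with hki | hki | hki
    · rw [if_pos (by lia), if_pos (by lia), show i - 1 - k = i - 1 - (k + 1) + 1 by lia]
      exact (hf.adj _ (by lia)).symm
    · rw [if_pos (by lia), if_neg (by lia), show i - 1 - k = 0 by lia, hki]
      exact h
    · rw [if_neg (by lia), if_neg (by lia)]
      exact hf.adj _ hk

theorem IsIndexedPath.cons {f : ℕ → V} {n : ℕ} (hf : G.IsIndexedPath f n) {w : V}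
    (hw : G.Adj (f 0) w) (hfw : ∀ k ≤ n, f k ≠ w) :
    G.IsIndexedPath (fun k ↦ if k = 0 then w else f (k - 1)) (n + 1) where
  inj a ha b hb hab := by
    split_ifs at hab
    · lia
    · exact absurd hab.symm (hfw _ (by lia))
    · exact absurd hab (hfw _ (by lia))
    · have := hf.inj _ (by lia) _ (by lia) hab
      lia
  adj k hk := by
    rcases Nat.eq_zero_or_pos k with rfl | h
    · simpa using hw.symm
    · rw [if_neg (by lia), if_neg (by lia), show k + 1 - 1 = k - 1 + 1 by lia]
      exact hf.adj _ (by lia)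

theorem IsIndexedPath.lt_card [Fintype V] {f : ℕ → V} {n : ℕ} (hf : G.IsIndexedPath f n) :
    n < Fintype.card V := by
  have := Fintype.card_le_of_injective (fun k : Fin (n + 1) ↦ f k)
    (fun a b h ↦ Fin.ext (hf.inj _ (by lia) _ (by lia) h))
  simpa using this

theorem exists_isIndexedPath_maximal [Fintype V] [Nonempty V] (G : SimpleGraph V) :
    ∃ f n, G.IsIndexedPath f n ∧ ∀ g, ¬ G.IsIndexedPath g (n + 1) := by
  classical
  by_contra! h
  have key : ∀ n, ∃ f, G.IsIndexedPath f n := by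
    intro n
    induction n with
    | zero => exact ⟨fun _ ↦ Classical.arbitrary V, by intros; lia, by intros; lia⟩
    | succ n ih =>
      obtain ⟨f, hf⟩ := ih
      exact h f n hf
  obtain ⟨f, hf⟩ := key (Fintype.card V)
  exact lt_irrefl _ hf.lt_card

/-- The first vertex of an inextensible path has all its neighbours on the path. -/
theorem IsIndexedPath.exists_adj_notMem [Fintype V] [DecidableRel G.Adj] {f : ℕ → V} {n : ℕ}
    (hf : G.IsIndexedPath f n) (hmax : ∀ g, ¬ G.IsIndexedPath g (n + 1)) (s : Finset ℕ)
    (hs : s.card < G.degree (f 0)) : ∃ k ≤ n, 1 ≤ k ∧ k ∉ s ∧ G.Adj (f 0) (f k) := by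
  classical
  obtain ⟨w, hw, hws⟩ : ∃ w ∈ G.neighborFinset (f 0), w ∉ s.image f :=
    Finset.exists_mem_notMem_of_card_lt_card (Finset.card_image_le.trans_lt hs)
  rw [mem_neighborFinset] at hw
  by_cases hk : ∃ k ≤ n, f k = w
  · obtain ⟨k, hkn, rfl⟩ := hk
    refine ⟨k, hkn, ?_, fun h ↦ hws (Finset.mem_image_of_mem f h), hw⟩
    by_contra h0
    obtain rfl : k = 0 := by lia
    exact hw.ne rfl
  · push Not at hk
    exact absurd (hf.cons hw hk) (hmax _)

/-- In a graph of minimum degree at least four some path has two crossing chords, one of them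
incident with the first vertex of the path, and two further chords at that vertex. -/
theorem exists_isIndexedPath_chords [Fintype V] [Nonempty V] [DecidableRel G.Adj]
    (hdeg : ∀ v, 4 ≤ G.degree v) :
    ∃ f n i j m m', G.IsIndexedPath f n ∧ 2 ≤ i ∧ i < j ∧ j ≤ n ∧ i < m ∧ m < m' ∧ m' ≤ n ∧
      G.Adj (f 0) (f i) ∧ G.Adj (f 0) (f m) ∧ G.Adj (f 0) (f m') ∧ G.Adj (f (i - 1)) (f j) := by
  classical
  obtain ⟨f₀, n, hf₀, hmax⟩ := G.exists_isIndexedPath_maximal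
  have hex : ∃ i, ∃ f, G.IsIndexedPath f n ∧ 2 ≤ i ∧ i ≤ n ∧ G.Adj (f 0) (f i) := by
    obtain ⟨k, hkn, hk1, hks, hk⟩ := hf₀.exists_adj_notMem hmax {1}
      (lt_of_lt_of_le (by simp) (hdeg _))
    exact ⟨k, f₀, hf₀, by simp at hks; lia, hkn, hk⟩
  obtain ⟨f, hf, hi, hin, hadj⟩ := Nat.find_spec hex
  have hmin : ∀ g k, G.IsIndexedPath g n → 2 ≤ k → k ≤ n → G.Adj (g 0) (g k) →
      Nat.find hex ≤ k := fun g k h1 h2 h3 h4 ↦ Nat.find_min' hex ⟨g, h1, h2, h3, h4⟩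
  generalize Nat.find hex = i at *
  obtain ⟨m, hmn, hm1, hms, hm⟩ := hf.exists_adj_notMem hmax {1, i}
    (lt_of_le_of_lt Finset.card_le_two (by have := hdeg (f 0); lia))
  obtain ⟨m', hmn', hm1', hms', hm'⟩ := hf.exists_adj_notMem hmax {1, i, m}
    (lt_of_le_of_lt Finset.card_le_three (by have := hdeg (f 0); lia))
  have hg := hf.rotate (by lia) hin hadj
  obtain ⟨j, hjn, hj1, hjs, hj⟩ := hg.exists_adj_notMem hmax {1, i}
    (lt_of_le_of_lt Finset.card_le_two (by have := hdeg (f (if 0 < i then i - 1 - 0 else 0)); lia))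
  simp only [Finset.mem_insert, Finset.mem_singleton, not_or] at hms hms' hjs
  have him := hmin f m hf (by lia) hmn hm
  have him' := hmin f m' hf (by lia) hmn' hm'
  have hij := hmin _ j hg (by lia) hjn hj
  rw [if_pos (by lia), if_neg (by lia), Nat.sub_zero] at hj
  rcases lt_or_gt_of_ne hms'.2.2 with h | h
  · exact ⟨f, n, i, j, m', m, hf, hi, by lia, hjn, by lia, h, hmn, hadj, hm', hm, hj⟩
  · exact ⟨f, n, i, j, m, m', hf, hi, by lia, hjn, by lia, h, hmn', hadj, hm, hm', hj⟩

set_option synthInstance.maxHeartbeats 200000 in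
set_option synthInstance.maxSize 1000 in
theorem even_of_chord_residues {s x y z d p q : ZMod 4} (hd : d + x = y ∨ d + y = x)
    (hs : s + 2 = p ∨ s + 2 = q) (hx : x + 2 = p ∨ x + 2 = q) (hy : y + 2 = p ∨ y + 2 = q)
    (hz : z + 2 = p ∨ z + 2 = q) (hsx : s + x + 2 = p ∨ s + x + 2 = q)
    (hxz : x + z + 2 = p ∨ x + z + 2 = q) (hsxz : s + x + z + 2 = p ∨ s + x + z + 2 = q)
    (hsy : s + y + 2 = p ∨ s + y + 2 = q) (hds : d + s + 2 = p ∨ d + s + 2 = q)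
    (hd' : d = p ∨ d = q) : (p = 0 ∨ p = 2) ∧ (q = 0 ∨ q = 2) := by
  have three_gaps : ∀ p q s : ZMod 4, (s + 2 = p ∨ s + 2 = q) →
      ∀ x, (x + 2 = p ∨ x + 2 = q) → (s + x + 2 = p ∨ s + x + 2 = q) →
      ∀ z, (z + 2 = p ∨ z + 2 = q) → (x + z + 2 = p ∨ x + z + 2 = q) →
        (s + x + z + 2 = p ∨ s + x + z + 2 = q) → p = 2 ∨ q = 2 := by
    decide
  have crossing : ∀ p q : ZMod 4, (p = 2 ∨ q = 2) → ∀ s, (s + 2 = p ∨ s + 2 = q) →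
      ∀ x, (x + 2 = p ∨ x + 2 = q) → (s + x + 2 = p ∨ s + x + 2 = q) →
      ∀ d, (d = p ∨ d = q) → (d + s + 2 = p ∨ d + s + 2 = q) →
      ∀ y, (y + 2 = p ∨ y + 2 = q) → (s + y + 2 = p ∨ s + y + 2 = q) →
        (d + x = y ∨ d + y = x) → (p = 0 ∨ p = 2) ∧ (q = 0 ∨ q = 2) := by
    decide
  exact crossing p q (three_gaps p q s hs x hx hsx z hz hxz hsxz) s hs x hx hsx d hd' hds y hy hsy hd

theorem residues_of_four_le_degree [Fintype V] [Nonempty V] [DecidableRel G.Adj]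
    (hdeg : ∀ v, 4 ≤ G.degree v) {p q : ℕ} (hp : p < 4) (hq : q < 4)
    (hpq : ∀ N, G.HasCycleOfLength N → N % 4 = p ∨ N % 4 = q) : p % 2 = 0 ∧ q % 2 = 0 := by
  obtain ⟨f, n, i, j, m, m', hf, hi, hij, hjn, him, hmm, hmn, ai, am, am', aj⟩ :=
    exists_isIndexedPath_chords hdeg
  have a1 := hf.adj 0 (by lia)
  have aii : G.Adj (f (i - 1)) (f i) := by
    simpa [show i - 1 + 1 = i by lia] using hf.adj (i - 1) (by lia)
  have gap : ∀ a b, 1 ≤ a → a < b → b ≤ n → G.Adj (f 0) (f a) → G.Adj (f 0) (f b) →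
      G.HasCycleOfLength (b - a + 2) := fun a b h1 h2 h3 h4 h5 ↦ by
    simpa using hf.hasCycleOfLength_of_two_segments le_rfl h1 h2.le h3 (.inr h2) h4 h5.symm
  have c1 := gap 1 i (by lia) (by lia) (by lia) a1 ai
  have c2 := gap 1 m (by lia) (by lia) (by lia) a1 am
  have c3 := gap 1 m' (by lia) (by lia) (by lia) a1 am'
  have c4 := gap i m (by lia) (by lia) (by lia) ai am
  have c5 := gap i m' (by lia) (by lia) (by lia) ai am'
  have c6 := gap m m' (by lia) (by lia) (by lia) am am'
  have c7 := hf.hasCycleOfLength_of_two_segments (a := i - 1) le_rfl (by lia) hij.le hjn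
    (.inr hij) aii aj.symm
  have hg := hf.rotate (by lia) (by lia) ai
  have c8 := hg.hasCycleOfLength_of_two_segments (a := 0) (b := i - 1) (c := i) (d := j)
    (by lia) (by lia) hij.le hjn (.inr hij)
    (by simpa [show i - 1 < i by lia] using ai)
    (by simpa [show ¬ j < i by lia, show 0 < i by lia] using aj.symm)
  obtain ⟨c9, c10⟩ : G.HasCycleOfLength (m - j + (j - m) + (i + 1)) ∧
      G.HasCycleOfLength (m - j + (j - m) + 4) := by
    rcases le_total j m with h | h
    · have h9 := hf.hasCycleOfLength_of_two_segments (a := 0) (b := i - 1) (by lia) (by lia) h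
        (by lia) (.inl (by lia)) aj am.symm
      have h10 := hf.hasCycleOfLength_of_segment (x := 0) (y := i) (z := i - 1) (by lia) hij
        (by lia) (by lia) h (by lia) ai aii.symm aj am.symm
      rw [show i - 1 - 0 + (m - j) + 2 = m - j + (j - m) + (i + 1) by clear * - hi h; lia] at h9
      rw [show m - j + 4 = m - j + (j - m) + 4 by clear * - h; lia] at h10
      exact ⟨h9, h10⟩
    · have h9 := hg.hasCycleOfLength_of_two_segments (a := 0) (b := i - 1) (by lia) (by lia) h
        (by lia) (.inl (by lia)) (by simpa [show i - 1 < i by lia, show ¬ m < i by lia] using am)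
        (by simpa [show ¬ j < i by lia, show 0 < i by lia] using aj.symm)
      have h10 := hf.hasCycleOfLength_of_segment (x := i - 1) (y := i) (z := 0) (by lia) him
        (by lia) (by lia) h (by lia) aii ai.symm am aj.symm
      rw [show i - 1 - 0 + (j - m) + 2 = m - j + (j - m) + (i + 1) by clear * - hi h; lia] at h9
      rw [show j - m + 4 = m - j + (j - m) + 4 by clear * - h; lia] at h10
      exact ⟨h9, h10⟩
  have cast : ∀ {N k : ℕ}, G.HasCycleOfLength N → k ≡ N [MOD 4] →
      (k : ZMod 4) = p ∨ (k : ZMod 4) = q := fun {N k} hN hk ↦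
    (hpq N hN).imp (fun h ↦ (ZMod.natCast_eq_natCast_iff' _ _ 4).mpr (by rw [hk, ← h]; simp))
      (fun h ↦ (ZMod.natCast_eq_natCast_iff' _ _ 4).mpr (by rw [hk, ← h]; simp))
  obtain ⟨s, rfl⟩ : ∃ s, i = s + 1 := ⟨i - 1, by lia⟩
  obtain ⟨x, rfl⟩ : ∃ x, m = s + 1 + x := ⟨m - (s + 1), by lia⟩
  obtain ⟨y, rfl⟩ : ∃ y, j = s + 1 + y := ⟨j - (s + 1), by lia⟩
  obtain ⟨z, rfl⟩ : ∃ z, m' = s + 1 + x + z := ⟨m' - (s + 1 + x), by lia⟩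
  obtain ⟨d, hd, hdd⟩ : ∃ d, (d + x = y ∨ d + y = x) ∧ d = (x - y) + (y - x) :=
    ⟨_, by lia, rfl⟩
  have := even_of_chord_residues (s := s) (x := x) (y := y) (z := z) (d := d) (p := p) (q := q)
    (by exact_mod_cast hd.imp (congrArg (Nat.cast (R := ZMod 4))) (congrArg Nat.cast))
    (by exact_mod_cast cast c1 (k := s + 2) (by unfold Nat.ModEq; lia))
    (by exact_mod_cast cast c4 (k := x + 2) (by unfold Nat.ModEq; lia))
    (by exact_mod_cast cast c7 (k := y + 2) (by unfold Nat.ModEq; lia))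
    (by exact_mod_cast cast c6 (k := z + 2) (by unfold Nat.ModEq; lia))
    (by exact_mod_cast cast c2 (k := s + x + 2) (by unfold Nat.ModEq; lia))
    (by exact_mod_cast cast c5 (k := x + z + 2) (by unfold Nat.ModEq; lia))
    (by exact_mod_cast cast c3 (k := s + x + z + 2) (by unfold Nat.ModEq; lia))
    (by exact_mod_cast cast c8 (k := s + y + 2) (by unfold Nat.ModEq; lia))
    (by exact_mod_cast cast c9 (k := d + s + 2) (by unfold Nat.ModEq; lia))
    (by exact_mod_cast cast c10 (k := d) (by unfold Nat.ModEq; lia))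
  have even : ∀ t : ℕ, t < 4 → (t : ZMod 4) = 0 ∨ (t : ZMod 4) = 2 → t % 2 = 0 := by decide
  exact ⟨even p hp this.1, even q hq this.2⟩

/-- In a connected graph of maximum degree at most two every cycle is Hamiltonian. -/
theorem Walk.IsCycle.length_eq_card_of_degree_le_two [Fintype V] [DecidableRel G.Adj]
    (hconn : G.Connected) (hdeg : ∀ v, G.degree v ≤ 2) {u : V} {c : G.Walk u u}
    (hc : c.IsCycle) : c.length = Fintype.card V := by
  classical
  have hclosed : ∀ v w, v ∈ c.support → G.Adj v w → w ∈ c.support := by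
    intro v w hv hvw
    have hsub : c.toSubgraph.neighborSet v ⊆ G.neighborSet v := c.toSubgraph.neighborSet_subset v
    have heq : c.toSubgraph.neighborSet v = G.neighborSet v := by
      refine Set.eq_of_subset_of_ncard_le hsub ?_ (Set.toFinite _)
      rw [hc.ncard_neighborSet_toSubgraph_eq_two hv, Set.ncard_eq_toFinset_card']
      exact hdeg v
    have : w ∈ c.toSubgraph.neighborSet v := heq ▸ hvw
    exact Walk.mem_support_of_adj_toSubgraph (this : c.toSubgraph.Adj v w).symm
  have hwalk : ∀ v w, G.Walk v w → v ∈ c.support → w ∈ c.support := by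
    intro v w p
    induction p with
    | nil => exact id
    | cons h _ ih => exact fun hv ↦ ih (hclosed _ _ hv h)
  have hall : ∀ w, w ∈ c.support.tail := fun w ↦ by
    have hw := hwalk u w (hconn u w).some c.start_mem_support
    rcases (Walk.mem_support_iff c).mp hw with rfl | h
    · exact Walk.end_mem_tail_support hc.not_nil
    · exact h
  have huniv : c.support.tail.toFinset = Finset.univ := by ext w; simpa using hall w
  rw [← Finset.card_univ, ← huniv, List.toFinset_card_of_nodup hc.support_nodup]
  simp

theorem Walk.even_length_bypass_iff [DecidableEq V]
    (heven : ∀ (u : V) (c : G.Walk u u), c.IsCycle → Even c.length) {u v : V} (p : G.Walk u v) :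
    Even p.bypass.length ↔ Even p.length := by
  induction p with
  | nil => simp [Walk.bypass]
  | @cons u v w h p ih =>
    simp only [Walk.bypass]
    split_ifs with hu
    · have hodd : Odd (p.bypass.takeUntil u hu).length := by
        have hpath := p.bypass_isPath.takeUntil hu
        by_cases he : s(u, v) ∈ (p.bypass.takeUntil u hu).edges
        · rw [hpath.length_eq_one_of_mem_edges (Sym2.eq_swap ▸ he)]
          exact odd_one
        · have := heven _ _ ((Walk.cons_isCycle_iff _ h).mpr ⟨hpath, he⟩)
          rw [Walk.length_cons] at this
          grind
      have hsum := congrArg Walk.length (p.bypass.take_spec hu)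
      rw [Walk.length_append] at hsum
      rw [Walk.length_cons]
      grind
    · simp only [Walk.length_cons, Nat.even_add_one, ih]

theorem colorable_two_of_forall_isCycle_even
    (heven : ∀ (u : V) (c : G.Walk u u), c.IsCycle → Even c.length) : G.Colorable 2 := by
  classical
  refine two_colorable_iff_forall_loop_even.mpr fun u w ↦ ?_
  rw [← Walk.even_length_bypass_iff heven,
    Walk.length_eq_zero_iff.mpr (Walk.isPath_iff_nil.mp w.bypass_isPath)]
  exact Even.zero

end SimpleGraph


/-- Let `G` be a finite connected simple graph with all vertex degrees even,
whose cycle lengths take exactly the two residues `i ≠ j` modulo 4.  If `G` is regular,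
then `{i, j} = {0, 2}`; equivalently every cycle of `G` has even length, i.e. `G` is
bipartite (2-colorable). -/
theorem euler_two_cycle_types_regular_implies_bipartite
    {V : Type*} [Fintype V] (G : SimpleGraph V) [DecidableRel G.Adj]
    (hconn : G.Connected)
    (heven : ∀ v : V, Even (G.degree v))
    (i j : ℕ) (hij : i ≠ j)
    (hres : {r : ℕ | ∃ (u : V) (c : G.Walk u u), c.IsCycle ∧ c.length % 4 = r}
              = {i, j})
    (hreg : ∃ r : ℕ, G.IsRegularOfDegree r) :
    ({i, j} : Set ℕ) = {0, 2} ∧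
      (∀ (u : V) (c : G.Walk u u), c.IsCycle → Even c.length) ∧
      G.Colorable 2 := by
  classical
  obtain ⟨r, hr⟩ := hreg
  have : Nonempty V := hconn.nonempty
  have hmem : ∀ (u : V) (c : G.Walk u u), c.IsCycle → c.length % 4 = i ∨ c.length % 4 = j := by
    intro u c hc
    have : c.length % 4 ∈ ({i, j} : Set ℕ) := hres ▸ ⟨u, c, hc, rfl⟩
    simpa using this
  obtain ⟨u, c, hc, hci⟩ : i ∈ {r : ℕ | ∃ (u : V) (c : G.Walk u u), c.IsCycle ∧ c.length % 4 = r} :=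
    hres ▸ Set.mem_insert i {j}
  obtain ⟨v, d, hd, hdj⟩ : j ∈ {r : ℕ | ∃ (u : V) (c : G.Walk u u), c.IsCycle ∧ c.length % 4 = r} :=
    hres ▸ Set.mem_insert_of_mem i rfl
  have hr4 : 4 ≤ r := by
    have hre : Even r := hr (Classical.arbitrary V) ▸ heven _
    by_contra hlt
    have hdeg : ∀ v, G.degree v ≤ 2 := fun v ↦ by
      rw [hr v]
      grind
    have h₁ := hc.length_eq_card_of_degree_le_two hconn hdeg
    have h₂ := hd.length_eq_card_of_degree_le_two hconn hdeg
    exact hij (by rw [← hci, ← hdj, h₁, h₂])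
  have hpar : i % 2 = 0 ∧ j % 2 = 0 := by
    refine SimpleGraph.residues_of_four_le_degree (G := G) (fun v ↦ (hr v).symm ▸ hr4)
      (by lia) (by lia) ?_
    rintro N ⟨u, c, hc, rfl⟩
    exact hmem u c hc
  have hevencyc : ∀ (u : V) (c : G.Walk u u), c.IsCycle → Even c.length := fun u c hc ↦ by
    have := hmem u c hc
    rw [Nat.even_iff]
    lia
  refine ⟨?_, hevencyc, SimpleGraph.colorable_two_of_forall_isCycle_even hevencyc⟩
  obtain ⟨rfl, rfl⟩ | ⟨rfl, rfl⟩ : (i = 0 ∧ j = 2) ∨ (i = 2 ∧ j = 0) := by lia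
  · rfl
  · exact Set.pair_comm 2 0
end

section
/- Let G be a simple graph and let C₁ and C₂ be cycles in G of lengths n₁ and n₂ respectively. Suppose the intersection of the edge sets of C₁ and C₂ equals the edge set of a path P in G of length m with 1 ≤ m, and the intersection of the vertex (support) sets of C₁ and C₂ equals the vertex set of P. Then G contains a cycle of length n₁ + n₂ − 2m (the combined cycle, whose edge set is the symmetric difference of the edge sets of C₁ and C₂). -/
namespace SimpleGraph.Walk

variable {V : Type*} {G : SimpleGraph V}

/-- A path whose edges lie on another path with the same start is an initial segment of it. -/
theorem IsPath.exists_eq_append_of_edges_subset {u v x : V} {p : G.Walk u v} {q : G.Walk u x}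
    (hp : p.IsPath) (hq : q.IsPath) (h : p.edges ⊆ q.edges) :
    ∃ r : G.Walk v x, q = p.append r := by
  induction p with
  | nil => exact ⟨q, rfl⟩
  | @cons u w v hadj p ih =>
    have hmem : s(u, w) ∈ q.edges := h (by simp)
    have hw := hq.eq_snd_of_mem_edges hmem
    cases q with
    | nil => simp at hmem
    | cons hadj' q =>
      obtain rfl : w = _ := by simpa using hw
      rw [cons_isPath_iff] at hp hq
      obtain ⟨r, rfl⟩ := ih hp.1 hq.1 fun e he => by
        have := h (List.mem_cons_of_mem _ he)
        rw [edges_cons, List.mem_cons] at this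
        refine this.resolve_left ?_
        rintro rfl
        exact hp.2 (p.fst_mem_support_of_mem_edges he)
      exact ⟨r, rfl⟩

/-- Every edge of a cycle can be made its first edge, in either direction. -/
theorem IsCycle.exists_isCycle_cons {a u w : V} {c : G.Walk a a} (hc : c.IsCycle)
    (hadj : G.Adj u w) (h : s(u, w) ∈ c.edges) :
    ∃ q : G.Walk w u, (cons hadj q).IsCycle ∧ (cons hadj q).edges.Perm c.edges := by
  classical
  have hu := c.fst_mem_support_of_mem_edges h
  have hperm := (c.rotate_edges u hu).perm
  have hc' := hc.rotate hu
  generalize c.rotate u hu = d at hperm hc'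
  have hd : s(u, w) ∈ d.edges := hperm.mem_iff.2 h
  cases d with
  | nil => simp at hd
  | @cons _ x _ hadj' q =>
    by_cases hwx : w = x
    · subst hwx
      exact ⟨q, hc', hperm⟩
    · have hq : s(u, w) ∈ q.reverse.edges := by
        simpa [hwx, hadj'.ne] using hd
      obtain ⟨r, hr⟩ := IsPath.exists_eq_append_of_edges_subset
        (p := cons hadj nil) (by simpa using hadj.ne)
        ((cons_isCycle_iff q hadj').1 hc').1.reverse (by simpa using hq)
      have heq : (cons hadj' q).reverse = cons hadj (r.append (cons hadj'.symm nil)) := by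
        rw [reverse_cons, hr]
        rfl
      refine ⟨r.append (cons hadj'.symm nil), heq ▸ hc'.reverse, ?_⟩
      rw [← heq, edges_reverse]
      exact (List.reverse_perm _).trans hperm

/-- A nontrivial path whose edges lie on a cycle can be completed to a reparametrization of that
cycle. -/
theorem IsCycle.exists_isCycle_append {a u v : V} {c : G.Walk a a} {p : G.Walk u v}
    (hc : c.IsCycle) (hp : p.IsPath) (hnil : ¬p.Nil) (h : p.edges ⊆ c.edges) :
    ∃ q : G.Walk v u, (p.append q).IsCycle ∧ (p.append q).edges.Perm c.edges := by
  cases p with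
  | nil => simp at hnil
  | cons hadj p =>
    obtain ⟨q, hq, hperm⟩ := hc.exists_isCycle_cons hadj (h (by simp))
    rw [cons_isPath_iff] at hp
    obtain ⟨r, rfl⟩ := IsPath.exists_eq_append_of_edges_subset hp.1
      ((cons_isCycle_iff q hadj).1 hq).1 fun e he => by
        have := hperm.mem_iff.2 (h (List.mem_cons_of_mem _ he))
        rw [edges_cons, List.mem_cons] at this
        refine this.resolve_left ?_
        rintro rfl
        exact hp.2 (p.fst_mem_support_of_mem_edges he)
    exact ⟨r, hq, hperm⟩

end SimpleGraph.Walk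

/-- If two cycles `c₁`, `c₂` of lengths `n₁`, `n₂` in a simple graph `G`
intersect exactly in a path `p` of length `m ≥ 1` (both in edges and in vertices), then
`G` contains a cycle of length `n₁ + n₂ - 2m`, the combined cycle, whose edge set is the
symmetric difference of the edge sets of `c₁` and `c₂`. -/
theorem combined_cycle_of_path_intersection
    {V : Type*} (G : SimpleGraph V) {a b u v : V} (n₁ n₂ m : ℕ)
    (c₁ : G.Walk a a) (c₂ : G.Walk b b) (p : G.Walk u v)
    (hc₁ : c₁.IsCycle) (hc₂ : c₂.IsCycle) (hp : p.IsPath)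
    (hn₁ : c₁.length = n₁) (hn₂ : c₂.length = n₂)
    (hm : p.length = m) (hm1 : 1 ≤ m)
    (hedges : {e : Sym2 V | e ∈ c₁.edges} ∩ {e : Sym2 V | e ∈ c₂.edges}
      = {e : Sym2 V | e ∈ p.edges})
    (hsupp : {x : V | x ∈ c₁.support} ∩ {x : V | x ∈ c₂.support}
      = {x : V | x ∈ p.support}) :
    ∃ (w : V) (c : G.Walk w w), c.IsCycle ∧ c.length = n₁ + n₂ - 2 * m ∧
      {e : Sym2 V | e ∈ c.edges}
        = symmDiff {e : Sym2 V | e ∈ c₁.edges} {e : Sym2 V | e ∈ c₂.edges} := by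
  have hnil : ¬p.Nil := by
    rw [← SimpleGraph.Walk.length_eq_zero_iff]
    lia
  simp only [Set.ext_iff, Set.mem_inter_iff, Set.mem_ofPred_eq] at hedges hsupp
  obtain ⟨q₁, hq₁, hperm₁⟩ :=
    hc₁.exists_isCycle_append hp hnil fun e he => ((hedges e).2 he).1
  obtain ⟨q₂, hq₂, hperm₂⟩ :=
    hc₂.exists_isCycle_append hp hnil fun e he => ((hedges e).2 he).2
  have hlen₁ := hperm₁.length_eq
  have hlen₂ := hperm₂.length_eq
  have hmem₁ (e : Sym2 V) : e ∈ c₁.edges ↔ e ∈ p.edges ∨ e ∈ q₁.edges := by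
    rw [← hperm₁.mem_iff, SimpleGraph.Walk.edges_append, List.mem_append]
  have hmem₂ (e : Sym2 V) : e ∈ c₂.edges ↔ e ∈ p.edges ∨ e ∈ q₂.edges := by
    rw [← hperm₂.mem_iff, SimpleGraph.Walk.edges_append, List.mem_append]
  have hdisj₁ := hq₁.edges_nodup
  have hdisj₂ := hq₂.edges_nodup
  rw [SimpleGraph.Walk.edges_append, List.nodup_append'] at hdisj₁ hdisj₂
  have huv : u ≠ v := by
    rintro rfl
    exact hnil ((SimpleGraph.Walk.isPath_iff_nil).1 hp)
  have hpath₁ := hq₁.isPath_of_append_right hnil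
  have hpath₂ := hq₂.isPath_of_append_right hnil
  have hnil₁ : ¬q₁.Nil := SimpleGraph.Walk.not_nil_of_ne huv.symm
  have hnil₂ : ¬q₂.Nil := SimpleGraph.Walk.not_nil_of_ne huv.symm
  have hdisj : List.Disjoint q₁.edges q₂.edges := fun e he₁ he₂ =>
    hdisj₁.2.2 ((hedges e).1 ⟨(hmem₁ e).2 (.inr he₁), (hmem₂ e).2 (.inr he₂)⟩) he₁
  have hsub₁ : q₁.support ⊆ c₁.support := fun x hx => by
    obtain ⟨e, he, hxe⟩ :=
      (SimpleGraph.Walk.mem_support_iff_exists_mem_edges_of_not_nil hnil₁).1 hx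
    exact SimpleGraph.Walk.mem_support_of_mem_edges ((hmem₁ e).2 (.inr he)) hxe
  have hsub₂ : q₂.support ⊆ c₂.support := fun x hx => by
    obtain ⟨e, he, hxe⟩ :=
      (SimpleGraph.Walk.mem_support_iff_exists_mem_edges_of_not_nil hnil₂).1 hx
    exact SimpleGraph.Walk.mem_support_of_mem_edges ((hmem₂ e).2 (.inr he)) hxe
  refine ⟨v, q₁.append q₂.reverse, ⟨⟨⟨?_⟩, ?_⟩, ?_⟩, ?_, ?_⟩
  · rw [SimpleGraph.Walk.edges_append, SimpleGraph.Walk.edges_reverse, List.nodup_append']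
    exact ⟨hdisj₁.2.1, List.nodup_reverse.2 hdisj₂.2.1, by simpa using hdisj⟩
  · intro h
    have := congrArg SimpleGraph.Walk.length h
    rw [← SimpleGraph.Walk.length_eq_zero_iff] at hnil₁
    simp only [SimpleGraph.Walk.length_append, SimpleGraph.Walk.length_nil] at this
    lia
  · rw [SimpleGraph.Walk.tail_support_append, List.nodup_append']
    refine ⟨hpath₁.support_nodup.tail, hpath₂.reverse.support_nodup.tail, fun x hx₁ hx₂ => ?_⟩
    have hxp : x ∈ p.support := (hsupp x).1 ⟨hsub₁ (List.mem_of_mem_tail hx₁),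
      hsub₂ (by simpa using List.mem_of_mem_tail hx₂)⟩
    have hnodup := hq₁.support_nodup
    rw [SimpleGraph.Walk.tail_support_append, List.nodup_append'] at hnodup
    have hxu : x = u := (SimpleGraph.Walk.mem_support_iff p).1 hxp |>.resolve_right
      fun h => hnodup.2.2 h hx₁
    have hrev := hpath₂.reverse.support_nodup
    rw [← SimpleGraph.Walk.cons_tail_support, List.nodup_cons] at hrev
    exact hrev.1 (hxu ▸ hx₂)
  · simp only [SimpleGraph.Walk.length_edges, SimpleGraph.Walk.length_append,
      SimpleGraph.Walk.length_reverse] at hlen₁ hlen₂ ⊢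
    lia
  · ext e
    have h₁ := @hdisj₁.2.2 e
    have h₂ := @hdisj₂.2.2 e
    have h₃ := @hdisj e
    simp only [Set.mem_symmDiff, Set.mem_ofPred_eq, hmem₁, hmem₂, SimpleGraph.Walk.edges_append,
      SimpleGraph.Walk.edges_reverse, List.mem_append, List.mem_reverse]
    tauto
end

section
/- Let G be a simple graph in which every cycle has length congruent to 2 modulo 4. If C₁ and C₂ are cycles in G whose edge sets intersect exactly in the edge set of a path P of length m ≥ 1 and whose vertex (support) sets intersect exactly in the vertex set of P, then m is odd. -/
namespace SimpleGraph.Walk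

variable {V : Type*} {G : SimpleGraph V}

/-- A cycle through the edge `s(u, v)` can be traversed starting at `u` with `v` next. -/
theorem IsCycle.exists_cons_perm {u v : V} {c : G.Walk u u} (hc : c.IsCycle) (h : G.Adj u v)
    (he : s(u, v) ∈ c.edges) :
    ∃ q : G.Walk v u, (cons h q).IsCycle ∧ (cons h q).edges.Perm c.edges := by
  have of_snd_eq (d : G.Walk u u) (hd : d.IsCycle) (hs : d.snd = v) :
      ∃ q : G.Walk v u, (cons h q).IsCycle ∧ (cons h q).edges.Perm d.edges := by
    cases d with
    | nil => simp at hd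
    | cons h' q =>
      obtain rfl : _ = v := by simpa using hs
      exact ⟨q, hd, .refl _⟩
  have hv : v = c.snd ∨ v = c.penultimate := by
    have : v ∈ c.toSubgraph.neighborSet u := by
      simpa [Subgraph.mem_neighborSet, ← Subgraph.mem_edgeSet] using he
    rw [hc.neighborSet_toSubgraph_endpoint] at this
    simpa using this
  obtain hv | hv := hv
  · exact of_snd_eq c hc hv.symm
  · obtain ⟨q, hq, hperm⟩ := of_snd_eq c.reverse hc.reverse (by simp [hv])
    exact ⟨q, hq, hperm.trans (by simp [List.reverse_perm])⟩

/-- A path whose edges lie on a cycle can be completed to a traversal of that cycle. -/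
theorem IsCycle.exists_append_perm {a u v : V} {c : G.Walk a a} (hc : c.IsCycle)
    {p : G.Walk u v} (hp : p.IsPath) (hu : u ∈ c.support) (hpc : p.edges ⊆ c.edges) :
    ∃ q : G.Walk v u, (p.append q).IsCycle ∧ (p.append q).edges.Perm c.edges := by
  classical
  induction p using concatRec with
  | Hnil => exact ⟨c.rotate _ hu, by simpa using hc.rotate hu, (c.rotate_edges _ hu).perm⟩
  | @Hconcat u w v p h ih =>
    rw [concat_isPath_iff] at hp
    rw [edges_concat, List.concat_eq_append, List.append_subset] at hpc
    obtain ⟨q, hq, hperm⟩ := ih hp.1 hu hpc.1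
    have he : s(w, v) ∈ p.edges ++ q.edges := by
      rw [← edges_append]
      exact hperm.mem_iff.2 (hpc.2 (by simp))
    have he : s(w, v) ∈ q.edges := (List.mem_append.1 he).resolve_left
      fun h' => hp.2 (p.snd_mem_support_of_mem_edges h')
    by_cases hn : p.Nil
    · cases hn
      obtain ⟨r, hr, hrp⟩ := IsCycle.exists_cons_perm (by simpa using hq) h he
      exact ⟨r, by simpa [concat_append] using hr, by simpa [concat_append] using hrp.trans hperm⟩
    · have hqp := hq.isPath_of_append_right hn
      obtain rfl := hqp.eq_snd_of_mem_edges he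
      have hqn : ¬ q.Nil := fun h' => by cases h'; simp at he
      have hcons : (p.concat h).append q.tail = p.append q := by
        rw [concat_append, cons_tail_eq q hqn]
      exact ⟨q.tail, hcons ▸ hq, hcons ▸ hperm⟩

end SimpleGraph.Walk


/-- In a simple graph all of whose cycles have length `≡ 2 (mod 4)`, if two
cycles intersect exactly in a path of length `m ≥ 1` (both in edges and in vertices),
then `m` is odd. -/
theorem path_intersection_odd_of_all_cycles_two_mod_four
    {V : Type*} (G : SimpleGraph V)
    (hcyc : ∀ (w : V) (c : G.Walk w w), c.IsCycle → c.length % 4 = 2)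
    {a b u v : V} (m : ℕ)
    (c₁ : G.Walk a a) (c₂ : G.Walk b b) (p : G.Walk u v)
    (hc₁ : c₁.IsCycle) (hc₂ : c₂.IsCycle) (hp : p.IsPath)
    (hm : p.length = m) (hm1 : 1 ≤ m)
    (hedges : {e : Sym2 V | e ∈ c₁.edges} ∩ {e : Sym2 V | e ∈ c₂.edges}
      = {e : Sym2 V | e ∈ p.edges})
    (hsupp : {x : V | x ∈ c₁.support} ∩ {x : V | x ∈ c₂.support}
      = {x : V | x ∈ p.support}) :
    Odd m := by
  have hn : ¬ p.Nil := fun h => by cases h; simp at hm; omega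
  have he {e : Sym2 V} (h₁ : e ∈ c₁.edges) (h₂ : e ∈ c₂.edges) : e ∈ p.edges :=
    hedges.subset ⟨h₁, h₂⟩
  have hs {x : V} (h₁ : x ∈ c₁.support) (h₂ : x ∈ c₂.support) : x ∈ p.support :=
    hsupp.subset ⟨h₁, h₂⟩
  have hu := hsupp.superset p.start_mem_support
  obtain ⟨q₁, hq₁, hperm₁⟩ := hc₁.exists_append_perm hp hu.1
    fun e h => (hedges.superset h).1
  obtain ⟨q₂, hq₂, hperm₂⟩ := hc₂.exists_append_perm hp hu.2
    fun e h => (hedges.superset h).2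
  have mem_support {a : V} {c : G.Walk a a} {q : G.Walk v u} (hq : (p.append q).IsCycle)
      (hperm : (p.append q).edges.Perm c.edges) {x : V} (hx : x ∈ q.support) :
      x ∈ c.support := by
    obtain ⟨e, hce, hxe⟩ := (SimpleGraph.Walk.mem_support_iff_exists_mem_edges_of_not_nil
      hq.not_nil).1 ((SimpleGraph.Walk.mem_support_append_iff _ _).2 (.inr hx))
    exact SimpleGraph.Walk.mem_support_of_mem_edges (hperm.mem_iff.1 hce) hxe
  have hp₁ := hq₁.isPath_of_append_right hn
  have hp₂ := hq₂.isPath_of_append_right hn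
  have hcycle : (q₁.append q₂.reverse).IsCycle := by
    refine hp₁.isCycle_append hp₂.reverse (fun x hx₁ hx₂ => ?_) ?_
    · have hx₁' := List.mem_of_mem_tail hx₁
      have hx₂' : x ∈ q₂.support := by simpa using List.mem_of_mem_tail hx₂
      have hxp := hs (mem_support hq₁ hperm₁ hx₁') (mem_support hq₂ hperm₂ hx₂')
      have hnodup := hq₁.support_nodup
      rw [SimpleGraph.Walk.tail_support_append, List.nodup_append'] at hnodup
      have hxu : x = u := by
        rw [SimpleGraph.Walk.mem_support_iff] at hxp
        exact hxp.resolve_right fun h => hnodup.2.2 h hx₁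
      have := hp₂.reverse.support_nodup
      rw [← SimpleGraph.Walk.cons_tail_support, List.nodup_cons] at this
      exact this.1 (hxu ▸ hx₂)
    · by_contra! hle
      rw [SimpleGraph.Walk.length_reverse] at hle
      obtain rfl := SimpleGraph.Walk.eq_of_length_le_one hle.1 hle.2
      have hnil : q₁.edges ≠ [] := fun h => by
        rw [SimpleGraph.Walk.edges_eq_nil] at h
        cases h
        exact hn (SimpleGraph.Walk.isPath_iff_nil.1 hp)
      obtain ⟨e, heq⟩ := List.exists_mem_of_ne_nil _ hnil
      have hep : e ∈ p.edges := he (hperm₁.mem_iff.1 (by simp [heq]))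
        (hperm₂.mem_iff.1 (by simp [heq]))
      have hnodup := hq₁.edges_nodup
      rw [SimpleGraph.Walk.edges_append, List.nodup_append'] at hnodup
      exact hnodup.2.2 hep heq
  have h₀ := hcyc _ _ hcycle
  have h₁ := hcyc _ _ hq₁
  have h₂ := hcyc _ _ hq₂
  simp only [SimpleGraph.Walk.length_append, SimpleGraph.Walk.length_reverse] at h₀ h₁ h₂
  rw [Nat.odd_iff]
  omega
end

section
/- Let G be a simple graph in which every cycle has odd length (in particular, if every cycle has length congruent to 1 modulo 4, or every cycle has length congruent to 3 modulo 4, or every cycle length is congruent to 1 or 3 modulo 4). Then any two cycles of G with distinct edge sets are edge-disjoint; equivalently, every edge of G lies on at most one cycle (up to equality of edge sets). -/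
namespace SimpleGraph.Walk

variable {V : Type*} {G : SimpleGraph V}

/-- Two distinct vertices of a cycle split it into two paths. -/
lemma IsCycle.exists_isPath_isPath {a x y : V} {c : G.Walk a a} (hc : c.IsCycle)
    (hx : x ∈ c.support) (hy : y ∈ c.support) (hxy : x ≠ y) :
    ∃ (p : G.Walk x y) (q : G.Walk y x), p.IsPath ∧ q.IsPath ∧
      p.length + q.length = c.length ∧
      (∀ e, e ∈ c.edges ↔ e ∈ p.edges ∨ e ∈ q.edges) ∧
      p.support ⊆ c.support ∧ q.support ⊆ c.support := by
  classical
  have hc' : (c.rotate x hx).IsCycle := hc.rotate hx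
  have hsupp : ∀ z, z ∈ (c.rotate x hx).support ↔ z ∈ c.support := fun z ↦
    c.mem_support_rotate_iff x hx
  have hedges : ∀ e, e ∈ (c.rotate x hx).edges ↔ e ∈ c.edges := fun e ↦
    (c.rotate_edges x hx).perm.mem_iff
  have hlen : (c.rotate x hx).length = c.length := by
    rw [← length_edges, ← length_edges, (c.rotate_edges x hx).perm.length_eq]
  obtain ⟨p, q, hpq⟩ := (mem_support_iff_exists_append (p := c.rotate x hx)).mp ((hsupp y).mpr hy)
  rw [hpq] at hc' hsupp hedges hlen
  refine ⟨p, q, hc'.isPath_of_append_left (not_nil_of_ne hxy.symm),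
    hc'.isPath_of_append_right (not_nil_of_ne hxy), by simpa using hlen,
    fun e ↦ by simp [← hedges e], fun z hz ↦ ?_, fun z hz ↦ ?_⟩
  · exact (hsupp z).mp (by simp [mem_support_append_iff, hz])
  · exact (hsupp z).mp (by simp [mem_support_append_iff, hz])

/-- A path with ends in `S` which is not contained in the edge set `F` contains a path with
distinct ends in `S`, no inner vertex in `S`, and not contained in `F`. -/
lemma IsPath.exists_ear {u v : V} {q : G.Walk u v} (hq : q.IsPath) (S : Set V)
    (F : Set (Sym2 V)) (hu : u ∈ S) (hv : v ∈ S) (hqF : ∃ e ∈ q.edges, e ∉ F) :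
    ∃ (x y : V) (r : G.Walk x y), r.IsPath ∧ x ∈ S ∧ y ∈ S ∧ x ≠ y ∧
      (∃ e ∈ r.edges, e ∉ F) ∧ ∀ z ∈ r.support, z ∈ S → z = x ∨ z = y := by
  induction hn : q.length using Nat.strong_induction_on generalizing u v with
  | _ n ih =>
    subst hn
    by_cases hz : ∀ z ∈ q.support, z ∈ S → z = u ∨ z = v
    · refine ⟨u, v, q, hq, hu, hv, ?_, hqF, hz⟩
      rintro rfl
      obtain ⟨e, he, -⟩ := hqF
      simp [(isPath_iff_nil.mp hq).eq_nil] at he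
    · push Not at hz
      obtain ⟨z, hzq, hzS, hzu, hzv⟩ := hz
      obtain ⟨p, r, hp, hr, rfl⟩ := hq.mem_support_iff_exists_append.mp hzq
      have hp0 : p.length ≠ 0 := fun h ↦ hzu (eq_of_length_eq_zero h).symm
      have hr0 : r.length ≠ 0 := fun h ↦ hzv (eq_of_length_eq_zero h)
      obtain ⟨e, he, heF⟩ := hqF
      rw [edges_append, List.mem_append] at he
      rcases he with he | he
      · exact ih p.length (by simp; omega) hp hu hzS ⟨e, he, heF⟩ rfl
      · exact ih r.length (by simp; omega) hr hzS hv ⟨e, he, heF⟩ rfl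

/-- Two paths between distinct vertices which share only their ends and are not the same single
edge form a cycle. -/
lemma IsPath.isCycle_append_of_inter {x y : V} {r : G.Walk x y} {p : G.Walk y x}
    (hr : r.IsPath) (hp : p.IsPath) (hxy : x ≠ y)
    (hinter : ∀ z ∈ r.support, z ∈ p.support → z = x ∨ z = y)
    (hedge : ∃ e ∈ r.edges, e ∉ p.edges) : (r.append p).IsCycle := by
  refine hr.isCycle_append hp (fun z hzr hzp ↦ ?_) ?_
  · have hr' := hr.support_nodup
    have hp' := hp.support_nodup
    rw [← cons_tail_support, List.nodup_cons] at hr' hp'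
    rcases hinter z (List.mem_of_mem_tail hzr) (List.mem_of_mem_tail hzp) with rfl | rfl
    · exact hr'.1 hzr
    · exact hp'.1 hzp
  · by_contra! h
    have hr0 : r.length ≠ 0 := fun h ↦ hxy (eq_of_length_eq_zero h)
    have hp0 : p.length ≠ 0 := fun h ↦ hxy (eq_of_length_eq_zero h).symm
    obtain ⟨e, her, hep⟩ := hedge
    cases r with
    | nil => exact hxy rfl
    | cons _ r =>
      cases p with
      | nil => exact hxy rfl
      | cons _ p =>
        cases r with
        | cons _ _ => simp at h
        | nil =>
          cases p with
          | cons _ _ => simp at h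
          | nil => simp_all [Sym2.eq_swap]

/-- If all cycles are odd, then a cycle sharing an edge with another one is contained in it. -/
lemma IsCycle.edges_subset_of_all_cycles_odd
    (hodd : ∀ (w : V) (c : G.Walk w w), c.IsCycle → Odd c.length)
    {a b : V} {c₁ : G.Walk a a} {c₂ : G.Walk b b} (h₁ : c₁.IsCycle) (h₂ : c₂.IsCycle)
    {e : Sym2 V} (he₁ : e ∈ c₁.edges) (he₂ : e ∈ c₂.edges) : c₂.edges ⊆ c₁.edges := by
  intro f hf₂
  by_contra hf₁
  induction e with
  | _ u v =>
  have hu := c₁.fst_mem_support_of_mem_edges he₁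
  have hv := c₁.snd_mem_support_of_mem_edges he₁
  obtain ⟨p, q, hp, hq, -, hpq, -, -⟩ := h₂.exists_isPath_isPath
    (c₂.fst_mem_support_of_mem_edges he₂) (c₂.snd_mem_support_of_mem_edges he₂)
    (c₁.adj_of_mem_edges he₁).ne
  obtain ⟨x, y, r, hr, hx, hy, hxy, ⟨g, hgr, hg⟩, hrS⟩ : ∃ (x y : V) (r : G.Walk x y),
      r.IsPath ∧ x ∈ {z | z ∈ c₁.support} ∧ y ∈ {z | z ∈ c₁.support} ∧ x ≠ y ∧
      (∃ e ∈ r.edges, e ∉ {e | e ∈ c₁.edges}) ∧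
      ∀ z ∈ r.support, z ∈ {z | z ∈ c₁.support} → z = x ∨ z = y := by
    rcases (hpq f).mp hf₂ with hf | hf
    · exact hp.exists_ear _ _ hu hv ⟨f, hf, hf₁⟩
    · exact hq.exists_ear _ _ hv hu ⟨f, hf, hf₁⟩
  obtain ⟨s, t, hs, ht, hlen, hst, hsS, htS⟩ := h₁.exists_isPath_isPath hx hy hxy
  have hgst : g ∉ s.edges ∧ g ∉ t.edges := by
    simpa [hst] using hg
  have hrt := hodd x _ (hr.isCycle_append_of_inter ht hxy
    (fun z hz hzt ↦ hrS z hz (htS hzt)) ⟨g, hgr, hgst.2⟩)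
  have hrs := hodd x _ (hr.isCycle_append_of_inter hs.reverse hxy
    (fun z hz hzs ↦ hrS z hz (hsS (by simpa using hzs))) ⟨g, hgr, by simpa using hgst.1⟩)
  have hc := hodd a c₁ h₁
  rw [length_append] at hrt hrs
  rw [length_reverse] at hrs
  grind

end SimpleGraph.Walk

/-- In a simple graph all of whose cycles have odd length, any two cycles
with distinct edge sets are edge-disjoint; equivalently, every edge lies on at most one
cycle (up to equality of edge sets). -/
theorem cycles_edge_disjoint_of_all_cycles_odd
    {V : Type*} (G : SimpleGraph V)
    (hodd : ∀ (w : V) (c : G.Walk w w), c.IsCycle → Odd c.length) :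
    ∀ (a b : V) (c₁ : G.Walk a a) (c₂ : G.Walk b b), c₁.IsCycle → c₂.IsCycle →
      {e : Sym2 V | e ∈ c₁.edges} ≠ {e : Sym2 V | e ∈ c₂.edges} →
      Disjoint {e : Sym2 V | e ∈ c₁.edges} {e : Sym2 V | e ∈ c₂.edges} := by
  intro a b c₁ c₂ h₁ h₂ hne
  rw [Set.disjoint_left]
  intro e he₁ he₂
  exact hne (Set.Subset.antisymm
    (SimpleGraph.Walk.IsCycle.edges_subset_of_all_cycles_odd hodd h₂ h₁ he₂ he₁)
    (SimpleGraph.Walk.IsCycle.edges_subset_of_all_cycles_odd hodd h₁ h₂ he₁ he₂))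
end

section
/- Let G be a finite connected simple graph with at least one edge in which every vertex has even degree and every cycle has odd length. Then G is regular if and only if G is isomorphic to a cycle graph C_n with n odd, n ≥ 3. -/
namespace SimpleGraph

variable {V : Type*} {G : SimpleGraph V}

/-- Closing a path of length at least two by an edge gives a cycle. -/
lemma Walk.IsPath.cons_isCycle {u v : V} {p : G.Walk u v} (hp : p.IsPath) (h : G.Adj v u)
    (hlen : 2 ≤ p.length) : (Walk.cons h p).IsCycle :=
  Walk.isCycle_iff_isPath_tail_and_le_length.mpr ⟨by simpa using hp, by simpa using hlen⟩

/-- If all cycles are odd, then two neighbours of the first vertex of a path that lie on the path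
have positions of different parity. -/
lemma Walk.IsPath.odd_sub_of_adj_start
    (hodd : ∀ (u : V) (c : G.Walk u u), c.IsCycle → Odd c.length) {u v : V} {p : G.Walk u v}
    (hp : p.IsPath) {i j : ℕ} (hi : G.Adj u (p.getVert i)) (hj : G.Adj u (p.getVert j))
    (hij : i < j) (hjp : j ≤ p.length) : Odd (j - i) := by
  have hi0 : i ≠ 0 := by
    rintro rfl
    simp at hi
  have hend : (p.drop i).getVert (j - i) = p.getVert j := by
    rw [Walk.drop_getVert]
    congr 1
    lia
  have hu : u ∉ ((p.drop i).take (j - i)).support := fun hmem ↦ by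
    obtain ⟨k, hk, -⟩ := Walk.mem_support_iff_exists_getVert.mp hmem
    rw [Walk.take_getVert, Walk.drop_getVert, hp.getVert_eq_start_iff (by lia)] at hk
    lia
  have hq : (Walk.cons hi ((p.drop i).take (j - i))).IsPath := ((hp.drop i).take _).cons hu
  have hlen : ((p.drop i).take (j - i)).length = j - i := by
    simp [Walk.take_length, Walk.drop_length]
    lia
  have := hodd _ _ (hq.cons_isCycle (hend ▸ hj.symm) (by simp [hlen]; lia))
  simp only [Walk.length_cons, hlen] at this
  grind

/-- A finite nonempty graph all of whose cycles are odd has a vertex of degree at most two. -/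
lemma exists_degree_le_two_of_forall_odd_length [Fintype V] [Nonempty V] [DecidableRel G.Adj]
    (hodd : ∀ (u : V) (c : G.Walk u u), c.IsCycle → Odd c.length) : ∃ v, G.degree v ≤ 2 := by
  obtain ⟨u, v, p, hp, hmax⟩ := Walk.exists_isPath_forall_isPath_length_le_length G
  refine ⟨u, ?_⟩
  by_contra! h
  have hmem : ∀ w, G.Adj u w → ∃ i ≤ p.length, p.getVert i = w := fun w hw ↦ by
    have hw' : w ∈ p.support := by
      by_contra hw'
      have := hmax _ _ _ (hp.cons hw' (h := hw.symm))
      simp at this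
    obtain ⟨i, rfl, hi⟩ := Walk.mem_support_iff_exists_getVert.mp hw'
    exact ⟨i, hi, rfl⟩
  rw [← card_neighborFinset_eq_degree, Finset.two_lt_card] at h
  obtain ⟨a, ha, b, hb, c, hc, hab, hac, hbc⟩ := h
  rw [mem_neighborFinset] at ha hb hc
  obtain ⟨i, hi, rfl⟩ := hmem a ha
  obtain ⟨j, hj, rfl⟩ := hmem b hb
  obtain ⟨k, hk, rfl⟩ := hmem c hc
  have key {m n : ℕ} (hm : G.Adj u (p.getVert m)) (hn : G.Adj u (p.getVert n))
      (hmp : m ≤ p.length) (hnp : n ≤ p.length) (hne : p.getVert m ≠ p.getVert n) :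
      m % 2 ≠ n % 2 := by
    have hne : m ≠ n := fun h ↦ hne (h ▸ rfl)
    rcases hne.lt_or_gt with h | h
    · have := hp.odd_sub_of_adj_start hodd hm hn h hnp
      grind
    · have := hp.odd_sub_of_adj_start hodd hn hm h hmp
      grind
  have h₁ := key ha hb hi hj hab
  have h₂ := key ha hc hi hk hac
  have h₃ := key hb hc hj hk hbc
  lia

/-- An injective homomorphism that preserves degrees, from a nonempty graph to a connected graph,
is an isomorphism. -/
lemma Copy.nonempty_iso_of_degree_eq {W : Type*} {H : SimpleGraph W} [Nonempty W]
    [G.LocallyFinite] [H.LocallyFinite] (hG : G.Connected) (f : Copy H G)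
    (hdeg : ∀ w, G.degree (f w) = H.degree w) : Nonempty (H ≃g G) := by
  classical
  have hnbr (w : W) : (H.neighborFinset w).image f = G.neighborFinset (f w) := by
    refine Finset.eq_of_subset_of_card_le (fun x hx ↦ ?_) ?_
    · obtain ⟨y, hy, rfl⟩ := Finset.mem_image.mp hx
      rw [mem_neighborFinset] at hy ⊢
      exact f.toHom.map_adj hy
    · rw [Finset.card_image_of_injective (f := f) _ f.injective, card_neighborFinset_eq_degree,
        card_neighborFinset_eq_degree, hdeg]
  have hadj {w : W} {x : V} (h : G.Adj (f w) x) : ∃ y, H.Adj w y ∧ f y = x := by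
    simpa using (hnbr w).ge (by simpa using h)
  have hsurj : Function.Surjective f := fun x ↦ by
    obtain ⟨w⟩ := ‹Nonempty W›
    obtain ⟨p⟩ := hG (f w) x
    generalize hv : f w = v at p
    induction p generalizing w with
    | nil => exact ⟨w, hv⟩
    | cons h p ih =>
      subst hv
      obtain ⟨y, -, hy⟩ := hadj h
      exact ih y hy
  refine ⟨⟨Equiv.ofBijective f ⟨f.injective, hsurj⟩, fun {a b} ↦ ⟨fun h ↦ ?_, f.toHom.map_adj⟩⟩⟩
  obtain ⟨y, hy, hyb⟩ := hadj h
  exact f.injective hyb ▸ hy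

/-- A finite connected graph that is regular of degree two is a cycle graph. -/
lemma Connected.exists_iso_cycleGraph [Fintype V] [DecidableRel G.Adj] (hG : G.Connected)
    (hreg : G.IsRegularOfDegree 2) :
    ∃ (u : V) (c : G.Walk u u), c.IsCycle ∧ Nonempty (G ≃g cycleGraph c.length) := by
  have hcyc : ¬ G.IsAcyclic := fun hac ↦ by
    have : Nontrivial V := by
      obtain ⟨v⟩ := hG.nonempty
      obtain ⟨w, hw⟩ := (G.degree_pos_iff_exists_adj v).mp (by simp [hreg v])
      exact ⟨v, w, hw.ne⟩
    obtain ⟨v, hv⟩ := IsTree.exists_vert_degree_one_of_nontrivial ⟨hG, hac⟩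
    simp [hreg v] at hv
  simp only [IsAcyclic, not_forall, not_not] at hcyc
  obtain ⟨u, c, hc⟩ := hcyc
  refine ⟨u, c, hc, ?_⟩
  obtain ⟨f⟩ := (cycleGraph_isContained_iff hc.three_le_length).mpr ⟨u, c, hc, rfl⟩
  obtain ⟨n, hn⟩ := Nat.exists_eq_add_of_le' hc.three_le_length
  rw [hn] at f ⊢
  obtain ⟨e⟩ := f.nonempty_iso_of_degree_eq hG fun w ↦ by
    rw [hreg, cycleGraph_degree_three_le]
  exact ⟨e.symm⟩

end SimpleGraph

/-- Let `G` be a finite connected simple graph with at least one edge, all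
vertex degrees even, and every cycle of odd length.  Then `G` is regular if and only if
`G` is isomorphic to a cycle graph `C_n` with `n` odd, `n ≥ 3`. -/
theorem euler_all_cycles_odd_regular_iff_odd_cycle_graph
    {V : Type*} [Fintype V] (G : SimpleGraph V) [DecidableRel G.Adj]
    (hconn : G.Connected) (hedge : G.edgeSet.Nonempty)
    (heven : ∀ v : V, Even (G.degree v))
    (hodd : ∀ (u : V) (c : G.Walk u u), c.IsCycle → Odd c.length) :
    (∃ r : ℕ, G.IsRegularOfDegree r) ↔
      ∃ n : ℕ, 3 ≤ n ∧ Odd n ∧ Nonempty (G ≃g SimpleGraph.cycleGraph n) := by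
  constructor
  · rintro ⟨r, hr⟩
    have := hconn.nonempty
    obtain ⟨v, hv⟩ := SimpleGraph.exists_degree_le_two_of_forall_odd_length hodd
    have hpos : 0 < r := by
      obtain ⟨⟨a, b⟩, hab⟩ := hedge
      rw [← hr a, SimpleGraph.degree_pos_iff_exists_adj]
      exact ⟨b, hab⟩
    have hev := heven v
    rw [hr v] at hv hev
    obtain rfl : r = 2 := by grind
    obtain ⟨u, c, hc, hiso⟩ := hconn.exists_iso_cycleGraph hr
    exact ⟨c.length, hc.three_le_length, hodd u c hc, hiso⟩
  · rintro ⟨n, hn, -, ⟨e⟩⟩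
    obtain ⟨n, rfl⟩ := Nat.exists_eq_add_of_le' hn
    exact ⟨2, fun v ↦ by rw [← e.degree_eq, SimpleGraph.cycleGraph_degree_three_le]⟩
end
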